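/- arXiv:2007.15342 — 10 statements merged into one kernel-verified Lean document; each statement's English description precedes it below -/
import Mathlib

section
/- For every integer n ≥ 2, every tree t on n vertices, the average over all n! linear arrangements π of the cost D(t,π) equals (n² − 1)/3 (as a rational number). -/
open Finset

/-- Sum of dependency distances of graph `t` under the linear arrangement `π`:
vertices in consecutive positions are at distance 1. -/
noncomputable def cost {n : ℕ} (t : SimpleGraph (Fin n)) (π : Equiv.Perm (Fin n)) : ℕ :=
  letI := Classical.decRel t.Adj
  ∑ e ∈ t.edgeFinset,
    Sym2.lift ⟨fun u v => (((π u : ℕ) : ℤ) - ((π v : ℕ) : ℤ)).natAbs,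
      fun u v => by dsimp only; omega⟩ e

/-- Total distance of the pair `u v` over all arrangements. -/
def pairSum {n : ℕ} (u v : Fin n) : ℕ :=
  ∑ π : Equiv.Perm (Fin n), (((π u : ℕ) : ℤ) - ((π v : ℕ) : ℤ)).natAbs

lemma pairSum_eq {n : ℕ} (u v u' v' : Fin n) (h : u ≠ v) (h' : u' ≠ v') :
    pairSum u v = pairSum u' v' := by
  obtain ⟨σ, h1, h2⟩ : ∃ σ : Equiv.Perm (Fin n), σ u = u' ∧ σ v = v' := by
    refine ⟨Equiv.swap (Equiv.swap u u' v) v' * Equiv.swap u u', ?_, ?_⟩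
    · rw [Equiv.Perm.mul_apply, Equiv.swap_apply_left]
      apply Equiv.swap_apply_of_ne_of_ne _ h'
      intro hh
      apply h
      apply (Equiv.swap u u').injective
      rw [Equiv.swap_apply_left, ← hh]
    · rw [Equiv.Perm.mul_apply, Equiv.swap_apply_left]
  subst h1 h2
  unfold pairSum
  rw [← Equiv.sum_comp (Equiv.mulRight σ)
    (fun π : Equiv.Perm (Fin n) => (((π u : ℕ) : ℤ) - ((π v : ℕ) : ℤ)).natAbs)]
  simp only [Equiv.coe_mulRight, Equiv.Perm.mul_apply]

lemma row_sum (n m : ℕ) (h : m ≤ n) :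
    2 * ∑ j ∈ range m, (((n : ℤ) - j).natAbs : ℤ) + m ^ 2 = 2 * n * m + m := by
  induction m with
  | zero => simp
  | succ m ih =>
    have e : (((n : ℤ) - m).natAbs : ℤ) = n - m := by omega
    rw [sum_range_succ, e]
    have := ih (by omega)
    simp only [Nat.cast_add, Nat.cast_one]
    linarith

lemma tot_sum (n : ℕ) :
    3 * ∑ i ∈ range n, ∑ j ∈ range n, (((i : ℤ) - j).natAbs : ℤ) + n = n ^ 3 := by
  induction n with
  | zero => simp
  | succ n ih =>
    have h1 := row_sum n n le_rfl
    have h2 : ∑ i ∈ range n, (((i : ℤ) - n).natAbs : ℤ)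
        = ∑ j ∈ range n, (((n : ℤ) - j).natAbs : ℤ) :=
      sum_congr rfl fun i _ => by omega
    simp only [sum_range_succ, sum_add_distrib, h2]
    simp only [sub_self, Int.natAbs_zero]
    push_cast at *
    linarith

lemma pairSum_val {n : ℕ} (a b : Fin n) (h : a ≠ b) :
    3 * (pairSum a b : ℚ) = (n.factorial : ℚ) * (n + 1) := by
  have key : ∑ u : Fin n, ∑ v : Fin n, (pairSum u v : ℤ)
      = n.factorial * ∑ i ∈ range n, ∑ j ∈ range n, (((i : ℤ) - j).natAbs : ℤ) := by
    have e : ∀ π : Equiv.Perm (Fin n),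
        ∑ u : Fin n, ∑ v : Fin n, ((((π u : ℕ) : ℤ) - ((π v : ℕ) : ℤ)).natAbs : ℤ)
        = ∑ i ∈ range n, ∑ j ∈ range n, (((i : ℤ) - j).natAbs : ℤ) := by
      intro π
      rw [Equiv.sum_comp π (fun x : Fin n =>
        ∑ v : Fin n, ((((x : ℕ) : ℤ) - ((π v : ℕ) : ℤ)).natAbs : ℤ)), Finset.sum_range]
      refine sum_congr rfl fun x _ => ?_
      rw [Equiv.sum_comp π (fun y : Fin n =>
        ((((x : ℕ) : ℤ) - ((y : ℕ) : ℤ)).natAbs : ℤ)), Finset.sum_range]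
    calc _ = ∑ π : Equiv.Perm (Fin n), ∑ u : Fin n, ∑ v : Fin n,
          ((((π u : ℕ) : ℤ) - ((π v : ℕ) : ℤ)).natAbs : ℤ) := by
          unfold pairSum
          simp only [Nat.cast_sum]
          rw [sum_comm]
          conv_rhs => rw [sum_comm]
          rw [sum_comm]
          exact sum_congr rfl fun u _ => sum_comm
      _ = _ := by
          rw [sum_congr rfl fun π _ => e π, sum_const, card_univ, Fintype.card_perm,
            Fintype.card_fin, nsmul_eq_mul]
  have key2 : ∑ u : Fin n, ∑ v : Fin n, (pairSum u v : ℤ)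
      = n * (n - 1) * pairSum a b := by
    have e : ∀ u v : Fin n, (pairSum u v : ℤ)
        = (pairSum a b : ℤ) - if u = v then (pairSum a b : ℤ) else 0 := by
      intro u v
      split_ifs with huv
      · subst huv; simp [pairSum]
      · rw [pairSum_eq u v a b huv h]; simp
    rw [sum_congr rfl fun u _ => sum_congr rfl fun v _ => e u v]
    simp [sum_sub_distrib]
    ring
  have hn : 2 ≤ n := by
    have := a.2; have := b.2
    have : (a : ℕ) ≠ b := fun hh => h (Fin.ext hh)
    omega
  have t := tot_sum n
  have hz : (n : ℤ) * (n - 1) * (3 * pairSum a b - n.factorial * (n + 1)) = 0 := by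
    rw [key2] at key
    linear_combination 3 * key + (n.factorial : ℤ) * t
  have hn' : (n : ℤ) * (n - 1) ≠ 0 :=
    mul_ne_zero (by omega) (by omega)
  have := (mul_eq_zero.1 hz).resolve_left hn'
  have h3 : 3 * (pairSum a b : ℤ) = n.factorial * (n + 1) := by linarith
  exact_mod_cast h3

theorem avg_cost_eq_Drla (n : ℕ) (hn : 2 ≤ n) (t : SimpleGraph (Fin n))
    (ht : t.IsTree) :
    (∑ π : Equiv.Perm (Fin n), (cost t π : ℚ)) / (n.factorial : ℚ)
      = ((n : ℚ) ^ 2 - 1) / 3 := by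
  letI := Classical.decRel t.Adj
  have hc := ht.card_edgeFinset
  rw [Fintype.card_fin] at hc
  have hf : (n.factorial : ℚ) ≠ 0 := by exact_mod_cast n.factorial_ne_zero
  have main : ∑ π : Equiv.Perm (Fin n), (cost t π : ℚ)
      = ∑ e ∈ t.edgeFinset, (n.factorial : ℚ) * (n + 1) / 3 := by
    unfold cost
    simp only [Nat.cast_sum]
    rw [sum_comm]
    refine sum_congr rfl fun e he => ?_
    rw [SimpleGraph.mem_edgeFinset] at he
    induction e with
    | _ u v =>
      rw [← pairSum_val u v (t.ne_of_adj he)]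
      simp [pairSum]
  rw [main, sum_const, nsmul_eq_mul]
  have hc' : (#t.edgeFinset : ℚ) = n - 1 := by
    have h1 : (#t.edgeFinset : ℚ) + 1 = n := by exact_mod_cast hc
    linarith
  rw [hc']
  field_simp
  ring
end

section
/- For every integer n ≥ 3 and every tree t on n vertices, the minimum cost D_min(t) satisfies D_min(t) < (n² − 1)/3 (as rational numbers); in particular the denominator D_rla(n) − D_min(t) of the score Ω is strictly positive. -/
open Finset

/-- Minimum of `cost t` over all linear arrangements. -/
noncomputable def Dmin {n : ℕ} (t : SimpleGraph (Fin n)) : ℕ :=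
  Finset.univ.inf' Finset.univ_nonempty (cost t)

/-- Expected cost under a uniformly random linear arrangement: `(n² - 1)/3`. -/
noncomputable def Drla (n : ℕ) : ℚ := ((n : ℚ) ^ 2 - 1) / 3

/-- Length of an edge under an arrangement, as a rational. -/
noncomputable def elen {n : ℕ} (π : Equiv.Perm (Fin n)) (u v : Fin n) : ℚ :=
  |((π u : ℕ) : ℚ) - ((π v : ℕ) : ℚ)|

theorem elen_sym {n : ℕ} (π : Equiv.Perm (Fin n)) (u v : Fin n) : elen π u v = elen π v u :=
  abs_sub_comm _ _

theorem cost_cast {n : ℕ} (t : SimpleGraph (Fin n)) [DecidableRel t.Adj]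
    (π : Equiv.Perm (Fin n)) :
    (cost t π : ℚ) = ∑ e ∈ t.edgeFinset, Sym2.lift ⟨elen π, elen_sym π⟩ e := by
  unfold cost
  push_cast
  refine Finset.sum_congr (by ext; simp) ?_
  intro e _
  induction e with
  | h u v =>
    simp only [Sym2.lift_mk, elen]
    rw [Nat.cast_natAbs]
    push_cast
    rfl

theorem sum_last (n : ℕ) : ∑ i ∈ range n, |(i : ℚ) - n| = n * (n + 1) / 2 := by
  induction n with
  | zero => simp
  | succ n ih =>
    rw [Finset.sum_range_succ']
    have : ∀ i ∈ range n, |((i + 1 : ℕ) : ℚ) - ((n + 1 : ℕ) : ℚ)| = |(i : ℚ) - n| := by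
      intro i _
      push_cast
      congr 1
      ring
    rw [Finset.sum_congr rfl this, ih]
    have h : |((0 : ℕ) : ℚ) - ((n + 1 : ℕ) : ℚ)| = n + 1 := by
      rw [abs_sub_comm]
      push_cast
      rw [sub_zero, abs_of_nonneg (by positivity)]
    rw [h]
    push_cast
    ring

theorem sum_range_all (n : ℕ) :
    ∑ i ∈ range n, ∑ j ∈ range n, |(i : ℚ) - j| = n * (n ^ 2 - 1) / 3 := by
  induction n with
  | zero => simp
  | succ n ih =>
    rw [Finset.sum_range_succ]
    simp_rw [Finset.sum_range_succ]
    rw [Finset.sum_add_distrib, ih, sum_last]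
    have h : ∑ j ∈ range n, |(n : ℚ) - j| = n * (n + 1) / 2 := by
      rw [← sum_last]
      exact Finset.sum_congr rfl fun i _ => abs_sub_comm _ _
    rw [h]
    simp
    ring

theorem sum_fin_all (n : ℕ) :
    ∑ i : Fin n, ∑ j : Fin n, |((i : ℕ) : ℚ) - ((j : ℕ) : ℚ)| = n * (n ^ 2 - 1) / 3 := by
  rw [← sum_range_all, Finset.sum_range]
  exact Finset.sum_congr rfl fun i _ => by rw [Finset.sum_range]

theorem exists_perm {n : ℕ} {a b x y : Fin n} (hab : a ≠ b) (hxy : x ≠ y) :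
    ∃ σ : Equiv.Perm (Fin n), σ a = x ∧ σ b = y := by
  refine ⟨(Equiv.swap a x).trans (Equiv.swap (Equiv.swap a x b) y), ?_, ?_⟩
  · simp only [Equiv.trans_apply, Equiv.swap_apply_left]
    apply Equiv.swap_apply_of_ne_of_ne
    · intro h
      apply hab
      apply (Equiv.swap a x).injective
      rw [Equiv.swap_apply_left]
      exact h
    · exact hxy
  · simp

theorem sum_elen_eq {n : ℕ} {u v u' v' : Fin n} (h : u ≠ v) (h' : u' ≠ v') :
    ∑ π : Equiv.Perm (Fin n), elen π u v = ∑ π : Equiv.Perm (Fin n), elen π u' v' := by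
  obtain ⟨σ, h1, h2⟩ := exists_perm h h'
  symm
  apply Fintype.sum_equiv (Equiv.mulRight σ)
  intro π
  simp [elen, h1, h2]

theorem sum_elen {n : ℕ} {u v : Fin n} (h : u ≠ v) :
    (n * (n - 1) : ℚ) * ∑ π : Equiv.Perm (Fin n), elen π u v
      = Fintype.card (Equiv.Perm (Fin n)) * (n * (n ^ 2 - 1) / 3) := by
  have h1 : ∑ u' : Fin n, ∑ v' : Fin n, ∑ π : Equiv.Perm (Fin n), elen π u' v'
      = (n * (n - 1) : ℚ) * ∑ π : Equiv.Perm (Fin n), elen π u v := by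
    have : ∀ u' : Fin n, ∑ v' : Fin n, ∑ π : Equiv.Perm (Fin n), elen π u' v'
        = (n - 1 : ℚ) * ∑ π : Equiv.Perm (Fin n), elen π u v := by
      intro u'
      rw [← Finset.add_sum_erase _ _ (Finset.mem_univ u')]
      rw [Finset.sum_congr rfl (g := fun _ => ∑ π : Equiv.Perm (Fin n), elen π u v)
        (fun v' hv' => sum_elen_eq (Finset.ne_of_mem_erase hv').symm h)]
      have hn : 1 ≤ n := by have := u.2; omega
      simp [elen, Finset.card_erase_of_mem, hn]
    rw [Finset.sum_congr rfl fun u' _ => this u']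
    simp
    ring
  rw [← h1]
  have h2 : ∀ u' : Fin n, ∑ v' : Fin n, ∑ π : Equiv.Perm (Fin n), elen π u' v'
      = ∑ π : Equiv.Perm (Fin n), ∑ v' : Fin n, elen π u' v' := fun u' => Finset.sum_comm
  rw [Finset.sum_congr rfl fun u' _ => h2 u', Finset.sum_comm]
  have h3 : ∀ π : Equiv.Perm (Fin n), ∑ u' : Fin n, ∑ v' : Fin n, elen π u' v'
      = n * (n ^ 2 - 1) / 3 := by
    intro π
    rw [← sum_fin_all]
    apply Fintype.sum_equiv π
    intro i
    apply Fintype.sum_equiv π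
    intro j
    rfl
  rw [Finset.sum_congr rfl fun π _ => h3 π]
  simp

theorem sum_cost (n : ℕ) (hn : 3 ≤ n) (t : SimpleGraph (Fin n)) (ht : t.IsTree) :
    ∑ π : Equiv.Perm (Fin n), (cost t π : ℚ) = ∑ _π : Equiv.Perm (Fin n), Drla n := by
  classical
  simp_rw [cost_cast]
  rw [Finset.sum_comm]
  have hq : (3 : ℚ) ≤ n := by exact_mod_cast hn
  have key : ∀ e ∈ t.edgeFinset, ∑ π : Equiv.Perm (Fin n), Sym2.lift ⟨elen π, elen_sym π⟩ e
      = Fintype.card (Equiv.Perm (Fin n)) * ((n + 1) / 3 : ℚ) := by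
    intro e he
    induction e with
    | h u v =>
      have huv : u ≠ v := by
        rw [SimpleGraph.mem_edgeFinset, SimpleGraph.mem_edgeSet] at he
        exact he.ne
      simp only [Sym2.lift_mk]
      have h0 : (n * (n - 1) : ℚ) ≠ 0 := by
        apply mul_ne_zero <;> linarith
      apply mul_left_cancel₀ h0
      rw [sum_elen huv]
      ring
  rw [Finset.sum_congr rfl key]
  have hc := ht.card_edgeFinset
  rw [Fintype.card_fin] at hc
  have hc' : (t.edgeFinset.card : ℚ) = n - 1 := by
    have h : ((#t.edgeFinset + 1 : ℕ) : ℚ) = n := congrArg Nat.cast hc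
    push_cast at h
    linarith
  simp only [Finset.sum_const, nsmul_eq_mul, hc', Finset.card_univ, Drla]
  ring

theorem cost_swap {n : ℕ} (t : SimpleGraph (Fin n)) [DecidableRel t.Adj]
    (π : Equiv.Perm (Fin n)) (a b : Fin n)
    (ha : (π a : ℕ) = 0) (hb : (π b : ℕ) = 1) :
    (cost t (π * Equiv.swap a b) : ℚ) - cost t π = (t.degree b : ℚ) - t.degree a := by
  have hdeg : ∀ v, (t.degree v : ℚ) = ∑ e ∈ t.edgeFinset, if v ∈ e then (1 : ℚ) else 0 := by
    intro v
    rw [← SimpleGraph.card_incidenceFinset_eq_degree, SimpleGraph.incidenceFinset_eq_filter]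
    simp
  have hab : a ≠ b := by rintro rfl; omega
  rw [cost_cast, cost_cast, hdeg, hdeg, ← Finset.sum_sub_distrib, ← Finset.sum_sub_distrib]
  apply Finset.sum_congr rfl
  intro e he
  induction e with
  | h u v =>
    have huv : u ≠ v := by
      rw [SimpleGraph.mem_edgeFinset, SimpleGraph.mem_edgeSet] at he
      exact he.ne
    have hge : ∀ w, w ≠ a → w ≠ b → (2 : ℚ) ≤ (π w : ℕ) := by
      intro w h1 h2
      have h3 : (π w : ℕ) ≠ (π a : ℕ) := fun h => h1 (π.injective (Fin.ext h))
      have h4 : (π w : ℕ) ≠ (π b : ℕ) := fun h => h2 (π.injective (Fin.ext h))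
      have : 2 ≤ (π w : ℕ) := by omega
      exact_mod_cast this
    have main : ∀ w, w ≠ a → w ≠ b →
        (|(1 : ℚ) - (π w : ℕ)| = (π w : ℕ) - 1 ∧ |(π w : ℕ) - (1 : ℚ)| = (π w : ℕ) - 1) := by
      intro w h1 h2
      have := hge w h1 h2
      exact ⟨by rw [abs_of_nonpos (by linarith)]; ring, by rw [abs_of_nonneg (by linarith)]⟩
    simp only [Sym2.lift_mk, elen, Sym2.mem_iff, Equiv.Perm.mul_apply]
    by_cases hua : u = a
    · subst hua
      by_cases hvb : v = b
      · subst hvb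
        simp [ha, hb]
      · have hv := main v huv.symm hvb
        simp [ha, hb, huv, hab.symm, Ne.symm hvb,
          Equiv.swap_apply_of_ne_of_ne huv.symm hvb, hv]
    · by_cases hub : u = b
      · subst hub
        by_cases hva : v = a
        · subst hva
          simp [ha, hb]
        · have hv := main v hva huv.symm
          simp [ha, hb, hab, Ne.symm hva, Equiv.swap_apply_of_ne_of_ne hva huv.symm, hv]
      · have hu := main u hua hub
        by_cases hva : v = a
        · subst hva
          simp [ha, hb, hab.symm, Ne.symm hub, Equiv.swap_apply_of_ne_of_ne hua hub, hu]
        · by_cases hvb : v = b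
          · subst hvb
            simp [ha, hb, hab, Ne.symm hua, Equiv.swap_apply_of_ne_of_ne hua hub, hu]
          · simp [Equiv.swap_apply_of_ne_of_ne hua hub, Equiv.swap_apply_of_ne_of_ne hva hvb,
              Ne.symm hua, Ne.symm hub, Ne.symm hva, Ne.symm hvb]

theorem exists_lt (n : ℕ) (hn : 3 ≤ n) (t : SimpleGraph (Fin n)) (ht : t.IsTree) :
    ∃ π : Equiv.Perm (Fin n), (cost t π : ℚ) < Drla n := by
  classical
  by_contra! hcon
  have heq : ∀ π : Equiv.Perm (Fin n), (cost t π : ℚ) = Drla n := by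
    have := (Finset.sum_eq_sum_iff_of_le (s := Finset.univ) fun π _ => hcon π).1
      (sum_cost n hn t ht).symm
    exact fun π => (this π (Finset.mem_univ _)).symm
  have hdeg : ∀ a b, t.degree a = t.degree b := by
    intro a b
    by_cases hab : a = b
    · rw [hab]
    obtain ⟨π, h0, h1⟩ := exists_perm (x := (⟨0, by omega⟩ : Fin n)) (y := ⟨1, by omega⟩) hab
      (by simp)
    have := cost_swap t π a b (by rw [h0]) (by rw [h1])
    rw [heq, heq, sub_self] at this
    have h : (t.degree a : ℚ) = t.degree b := by linarith
    exact_mod_cast h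
  have hsum := t.sum_degrees_eq_twice_card_edges
  rw [Finset.sum_congr rfl fun v _ => hdeg v ⟨0, by omega⟩] at hsum
  have hc := ht.card_edgeFinset
  simp only [Finset.sum_const, Finset.card_univ, Fintype.card_fin, smul_eq_mul] at hsum hc
  generalize t.degree ⟨0, by omega⟩ = d at hsum
  rcases Nat.lt_or_ge d 2 with h | h
  · interval_cases d <;> omega
  · nlinarith

theorem Dmin_lt_Drla (n : ℕ) (hn : 3 ≤ n) (t : SimpleGraph (Fin n))
    (ht : t.IsTree) :
    (Dmin t : ℚ) < Drla n ∧ 0 < Drla n - (Dmin t : ℚ) := by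
  obtain ⟨π, hπ⟩ := exists_lt n hn t ht
  have h : Dmin t ≤ cost t π := Finset.inf'_le _ (Finset.mem_univ π)
  have h' : (Dmin t : ℚ) ≤ cost t π := by exact_mod_cast h
  constructor <;> linarith
end

section
/- For every integer n ≥ 3, every tree t on n vertices and every linear arrangement π, the score Ω(t,π) satisfies Ω(t,π) ≥ −(5n − 8 − 5(n mod 2))/(n + 2 − (n mod 2)); that is, this expression is a lower bound for the minimum of Ω over all trees on n vertices and all of their linear arrangements. -/
open Finset

/-- The optimality score `Ω`. -/
noncomputable def Omega {n : ℕ} (t : SimpleGraph (Fin n)) (π : Equiv.Perm (Fin n)) : ℚ :=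
  (Drla n - (cost t π : ℚ)) / (Drla n - (Dmin t : ℚ))

/-- Pure arrangement lemma: a parent function admits an arrangement of cost at most `n²/4`. -/
lemma exists_arr (q : ℕ → ℕ) (hq : ∀ i, 1 ≤ i → q i < i) : ∀ n : ℕ, ∃ f : ℕ → ℕ,
    (∀ i < n, f i < n) ∧ (∀ i < n, ∀ j < n, f i = f j → i = j) ∧
    4 * ∑ i ∈ Finset.Ico 1 n, |((f i : ℕ) : ℤ) - (f (q i) : ℤ)| ≤ (n : ℤ) ^ 2
  | 0 => ⟨id, by simp, by simp, by simp⟩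
  | 1 => ⟨id, by simp, by simp, by simp⟩
  | 2 => ⟨id, by simp, by simp, by
      have := hq 1 le_rfl
      have h0 : q 1 = 0 := by omega
      simp [h0]⟩
  | (m + 3) => by
      obtain ⟨f, h1, h2, h3⟩ := exists_arr q hq (m + 1)
      have ha := hq (m + 1) (by omega)
      have hb := hq (m + 2) (by omega)
      have hsplit : ∀ g : ℕ → ℤ, ∑ i ∈ Finset.Ico 1 (m + 3), g i
          = ∑ i ∈ Finset.Ico 1 (m + 1), g i + g (m + 1) + g (m + 2) := by
        intro g
        rw [Finset.sum_Ico_succ_top (by omega), Finset.sum_Ico_succ_top (by omega)]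
      -- shifting the old part
      have hshift : ∀ (g : ℕ → ℕ) (c : ℕ), (∀ i < m + 1, g i = f i + c) →
          ∑ i ∈ Finset.Ico 1 (m + 1), |((g i : ℕ) : ℤ) - (g (q i) : ℤ)|
          = ∑ i ∈ Finset.Ico 1 (m + 1), |((f i : ℕ) : ℤ) - (f (q i) : ℤ)| := by
        intro g c hg
        refine Finset.sum_congr rfl fun i hi => ?_
        rw [Finset.mem_Ico] at hi
        have := hq i hi.1
        rw [hg i hi.2, hg (q i) (by omega)]
        push_cast
        congr 1
        ring
      have key : ∃ g : ℕ → ℕ, ∃ c a b : ℕ, (∀ i < m + 1, g i = f i + c) ∧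
          g (m + 1) = a ∧ g (m + 2) = b ∧ a < m + 3 ∧ b < m + 3 ∧ a ≠ b ∧ c ≤ 2 ∧
          (∀ k < m + 1, k + c ≠ a ∧ k + c ≠ b) ∧
          |(a : ℤ) - g (q (m + 1))| + |(b : ℤ) - g (q (m + 2))| ≤ m + 2 := by
        by_cases hcase : q (m + 2) = m + 1
        · refine ⟨fun i => if i = m + 1 then 1 else if i = m + 2 then 0 else f i + 2,
            2, 1, 0, ?_, ?_, ?_, ?_⟩
          · intro i hi
            simp only [show i ≠ m + 1 by omega, show i ≠ m + 2 by omega, if_false]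
          · simp
          · simp
          · have := h1 _ ha
            simp only [hcase, show q (m + 1) ≠ m + 1 by omega, show q (m + 1) ≠ m + 2 by omega,
              if_false, if_true]
            clear h1 h2 h3 hsplit hshift hq
            grind
        · have hb' : q (m + 2) < m + 1 := by omega
          have := h1 _ ha
          have := h1 _ hb'
          by_cases hle : f (q (m + 1)) ≤ f (q (m + 2))
          · refine ⟨fun i => if i = m + 1 then 0 else if i = m + 2 then m + 2 else f i + 1,
              1, 0, m + 2, ?_, ?_, ?_, ?_⟩
            · intro i hi
              simp only [show i ≠ m + 1 by omega, show i ≠ m + 2 by omega, if_false]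
            · simp
            · simp
            · simp only [show q (m + 2) ≠ m + 1 by omega, show q (m + 2) ≠ m + 2 by omega,
                show q (m + 1) ≠ m + 1 by omega, show q (m + 1) ≠ m + 2 by omega,
                if_false]
              clear h1 h2 h3 hsplit hshift hq
              grind
          · refine ⟨fun i => if i = m + 1 then m + 2 else if i = m + 2 then 0 else f i + 1,
              1, m + 2, 0, ?_, ?_, ?_, ?_⟩
            · intro i hi
              simp only [show i ≠ m + 1 by omega, show i ≠ m + 2 by omega, if_false]
            · simp
            · simp
            · simp only [show q (m + 2) ≠ m + 1 by omega, show q (m + 2) ≠ m + 2 by omega,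
                show q (m + 1) ≠ m + 1 by omega, show q (m + 1) ≠ m + 2 by omega,
                if_false]
              clear h1 h2 h3 hsplit hshift hq
              grind
      obtain ⟨g, c, a, b, hg, hga, hgb, hla, hlb, hab, hc, hk, hcost⟩ := key
      refine ⟨g, ?_, ?_, ?_⟩
      · intro i hi
        rcases (by omega : i < m + 1 ∨ i = m + 1 ∨ i = m + 2) with h | rfl | rfl
        · have := h1 i h
          rw [hg i h]; omega
        · omega
        · omega
      · intro i hi j hj hij
        rcases (by omega : i < m + 1 ∨ i = m + 1 ∨ i = m + 2) with h | rfl | rfl <;>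
        rcases (by omega : j < m + 1 ∨ j = m + 1 ∨ j = m + 2) with h' | rfl | rfl
        · rw [hg i h, hg j h'] at hij
          exact h2 i h j h' (by omega)
        · have := hk _ (h1 i h); rw [hg i h] at hij; omega
        · have := hk _ (h1 i h); rw [hg i h] at hij; omega
        · have := hk _ (h1 j h'); rw [hg j h'] at hij; omega
        · rfl
        · omega
        · have := hk _ (h1 j h'); rw [hg j h'] at hij; omega
        · omega
        · rfl
      · rw [hsplit, hshift g c hg, hga, hgb]
        push_cast at h3 ⊢
        nlinarith

/-- The upper bound for the sum of the largest possible lengths. -/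
lemma sum_max_le : ∀ m : ℕ,
    4 * ∑ i ∈ Finset.range m, max ((i : ℤ) + 1) ((m : ℤ) - 1 - i) ≤ 3 * (m : ℤ) ^ 2 + (m % 2 : ℕ)
  | 0 => by simp
  | 1 => by simp
  | (m + 2) => by
      have ih := sum_max_le m
      rw [Finset.sum_range_succ, Finset.sum_range_succ']
      have h : ∑ k ∈ Finset.range m,
          max (((k + 1 : ℕ) : ℤ) + 1) (((m + 2 : ℕ) : ℤ) - 1 - ((k + 1 : ℕ) : ℤ))
          = ∑ k ∈ Finset.range m, max ((k : ℤ) + 1) ((m : ℤ) - 1 - k) + m := by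
        rw [show (m : ℤ) = ∑ k ∈ Finset.range m, (1 : ℤ) by simp, ← Finset.sum_add_distrib]
        refine Finset.sum_congr rfl fun k _ => ?_
        rw [← show (m : ℤ) = ∑ k ∈ Finset.range m, (1 : ℤ) by simp]
        push_cast
        omega
      rw [h]
      have e1 : max (((0 : ℕ) : ℤ) + 1) (((m + 2 : ℕ) : ℤ) - 1 - ((0 : ℕ) : ℤ)) = m + 1 := by
        push_cast; omega
      have e2 : max (((m + 1 : ℕ) : ℤ) + 1) (((m + 2 : ℕ) : ℤ) - 1 - ((m + 1 : ℕ) : ℤ))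
          = m + 2 := by
        push_cast; omega
      rw [e1, e2, show (m + 2) % 2 = m % 2 by omega]
      push_cast at ih ⊢
      nlinarith

/-- A rooted tree has a parent function, decreasing the distance to the root, and the cost is a
sum over the non-root vertices. -/
lemma exists_parent {n : ℕ} (t : SimpleGraph (Fin n)) (ht : t.IsTree) (r : Fin n) :
    ∃ par : Fin n → Fin n, (∀ v, v ≠ r → t.dist r (par v) < t.dist r v) ∧
      ∀ π : Equiv.Perm (Fin n), (cost t π : ℤ) =
        ∑ v ∈ Finset.univ.erase r, |((π v : ℕ) : ℤ) - ((π (par v) : ℕ) : ℤ)| := by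
  classical
  have h : ∀ v, ∃ w, v ≠ r → t.Adj v w ∧ t.dist r w < t.dist r v := by
    intro v
    by_cases hv : v = r
    · exact ⟨v, fun h => absurd hv h⟩
    · obtain ⟨p, hp⟩ := (ht.connected v r).exists_walk_length_eq_dist
      cases p with
      | nil => exact absurd rfl hv
      | cons hadj p' =>
        rename_i w
        refine ⟨w, fun _ => ⟨hadj, ?_⟩⟩
        have h1 := SimpleGraph.dist_le p'
        rw [SimpleGraph.Walk.length_cons] at hp
        rw [SimpleGraph.dist_comm (u := r) (v := w), SimpleGraph.dist_comm (u := r) (v := v)]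
        omega
  choose par hpar using h
  refine ⟨par, fun v hv => (hpar v hv).2, fun π => ?_⟩
  have hinj : Set.InjOn (fun v => s(v, par v)) (Finset.univ.erase r : Finset (Fin n)) := by
    intro v hv w hw hvw
    have hv' : v ≠ r := by simpa using hv
    have hw' : w ≠ r := by simpa using hw
    have h1 := (hpar v hv').2
    have h2 := (hpar w hw').2
    simp only [Sym2.eq_iff] at hvw
    rcases hvw with ⟨h, _⟩ | ⟨h, h'⟩
    · exact h
    · rw [h'] at h1
      rw [← h] at h2
      omega
  letI := Classical.decRel t.Adj
  have himg : (Finset.univ.erase r).image (fun v => s(v, par v)) = t.edgeFinset := by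
    apply Finset.eq_of_subset_of_card_le
    · intro e he
      rw [Finset.mem_image] at he
      obtain ⟨v, hv, rfl⟩ := he
      rw [SimpleGraph.mem_edgeFinset, SimpleGraph.mem_edgeSet]
      exact (hpar v (by simpa using hv)).1
    · rw [Finset.card_image_of_injOn hinj, Finset.card_erase_of_mem (Finset.mem_univ _),
        Finset.card_univ]
      have := ht.card_edgeFinset
      omega
  unfold cost
  rw [← himg, Finset.sum_image hinj]
  push_cast
  refine Finset.sum_congr rfl fun v _ => ?_
  simp

lemma cost_le {n : ℕ} (hn : 3 ≤ n) (t : SimpleGraph (Fin n)) (ht : t.IsTree)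
    (π : Equiv.Perm (Fin n)) :
    4 * (cost t π : ℤ) ≤ 3 * ((n : ℤ) - 1) ^ 2 + ((n - 1) % 2 : ℕ) := by
  obtain ⟨m, rfl⟩ : ∃ m, n = m + 1 := ⟨n - 1, by omega⟩
  obtain ⟨par, -, hc⟩ := exists_parent t ht (π.symm 0)
  rw [hc π]
  have h1 : ∑ v ∈ Finset.univ.erase (π.symm 0), |((π v : ℕ) : ℤ) - ((π (par v) : ℕ) : ℤ)|
      ≤ ∑ v ∈ Finset.univ.erase (π.symm 0), max ((π v : ℕ) : ℤ) ((m : ℤ) - (π v : ℕ)) := by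
    refine Finset.sum_le_sum fun v _ => ?_
    have := (π v).isLt
    have := (π (par v)).isLt
    grind
  have h2 : ∑ v ∈ Finset.univ.erase (π.symm 0), max ((π v : ℕ) : ℤ) ((m : ℤ) - (π v : ℕ))
      = ∑ i ∈ Finset.range m, max ((i : ℤ) + 1) ((m : ℤ) - 1 - i) := by
    have h3 : ∑ v, max ((π v : ℕ) : ℤ) ((m : ℤ) - (π v : ℕ))
        = ∑ v : Fin (m + 1), max ((v : ℕ) : ℤ) ((m : ℤ) - (v : ℕ)) :=
      Equiv.sum_comp π (fun v : Fin (m + 1) => max ((v : ℕ) : ℤ) ((m : ℤ) - (v : ℕ)))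
    rw [← Finset.add_sum_erase _ _ (Finset.mem_univ (π.symm 0)), Fin.sum_univ_succ] at h3
    simp only [Equiv.apply_symm_apply, add_right_inj] at h3
    rw [h3, ← Fin.sum_univ_eq_sum_range (fun i => max ((i : ℤ) + 1) ((m : ℤ) - 1 - i))]
    refine Finset.sum_congr rfl fun i _ => ?_
    simp only [Fin.val_succ]
    push_cast
    congr 1
    ring
  have h4 := sum_max_le m
  simp only [Nat.add_sub_cancel]
  push_cast at h4 ⊢
  rw [add_sub_cancel_right]
  omega

lemma Dmin_le {n : ℕ} (hn : 3 ≤ n) (t : SimpleGraph (Fin n)) (ht : t.IsTree) :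
    4 * (Dmin t : ℤ) ≤ (n : ℤ) ^ 2 := by
  obtain ⟨m, rfl⟩ : ∃ m, n = m + 1 := ⟨n - 1, by omega⟩
  obtain ⟨par, hd, hc⟩ := exists_parent t ht 0
  -- order the vertices by distance from the root
  let σ : Equiv.Perm (Fin (m + 1)) := Tuple.sort (fun v => t.dist 0 v)
  have hmono : Monotone ((fun v => t.dist 0 v) ∘ σ) := Tuple.monotone_sort _
  have h0 : σ 0 = 0 := by
    have h := hmono (Fin.zero_le (σ.symm 0))
    simp only [Function.comp, Equiv.apply_symm_apply, SimpleGraph.dist_self] at h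
    exact ((ht.connected.dist_eq_zero_iff).1 (Nat.le_zero.1 h)).symm
  have hidx : ∀ i : Fin (m + 1), i ≠ 0 → σ.symm (par (σ i)) < i := by
    intro i hi
    by_contra hcon
    have h := hmono (not_lt.1 hcon)
    simp only [Function.comp, Equiv.apply_symm_apply] at h
    have := hd (σ i) (fun h => hi (σ.injective (h.trans h0.symm)))
    omega
  let q : ℕ → ℕ := fun i => if h : i < m + 1 then ((σ.symm (par (σ ⟨i, h⟩)) : Fin (m + 1)) : ℕ)
    else 0
  have hq : ∀ i, 1 ≤ i → q i < i := by
    intro i hi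
    by_cases h : i < m + 1
    · simp only [q, h, dif_pos]
      exact hidx ⟨i, h⟩ (by intro h'; simp [Fin.ext_iff] at h'; omega)
    · simp only [q, h, dif_neg, not_false_eq_true]; omega
  obtain ⟨f, hf1, hf2, hf3⟩ := exists_arr q hq (m + 1)
  let F : Fin (m + 1) → Fin (m + 1) := fun i => ⟨f i, hf1 i i.isLt⟩
  have hF : Function.Injective F := by
    intro i j hij
    exact Fin.ext (hf2 i i.isLt j j.isLt (by simpa [F] using hij))
  let ρ : Equiv.Perm (Fin (m + 1)) :=
    σ.symm.trans (Equiv.ofBijective F (Finite.injective_iff_bijective.1 hF))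
  have hρ : ∀ v, ((ρ v : Fin (m + 1)) : ℕ) = f (σ.symm v) := fun v => rfl
  have hcost : (cost t ρ : ℤ) = ∑ i ∈ Finset.Ico 1 (m + 1), |((f i : ℕ) : ℤ) - (f (q i) : ℤ)| := by
    rw [hc ρ]
    have h3 : ∑ v, |((ρ v : ℕ) : ℤ) - ((ρ (par v) : ℕ) : ℤ)|
        = ∑ i, |((ρ (σ i) : ℕ) : ℤ) - ((ρ (par (σ i)) : ℕ) : ℤ)| :=
      (Equiv.sum_comp σ (fun v => |((ρ v : ℕ) : ℤ) - ((ρ (par v) : ℕ) : ℤ)|)).symm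
    rw [← Finset.add_sum_erase _ _ (Finset.mem_univ (0 : Fin (m + 1))), Fin.sum_univ_succ, h0,
      add_right_inj] at h3
    rw [h3, Finset.sum_Ico_eq_sum_range, Nat.add_sub_cancel,
      ← Fin.sum_univ_eq_sum_range
        (fun i => |((f (1 + i) : ℕ) : ℤ) - (f (q (1 + i)) : ℤ)|)]
    refine Finset.sum_congr rfl fun i _ => ?_
    rw [hρ, hρ, Equiv.symm_apply_apply, Fin.val_succ, add_comm 1 (i : ℕ)]
    have : q ((i : ℕ) + 1) = σ.symm (par (σ i.succ)) := by
      simp only [q, show (i : ℕ) + 1 < m + 1 by omega, dif_pos]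
      rfl
    rw [this]
  have hD : Dmin t ≤ cost t ρ := Finset.inf'_le _ (Finset.mem_univ ρ)
  rw [← hcost] at hf3
  have : (Dmin t : ℤ) ≤ cost t ρ := by exact_mod_cast hD
  linarith

theorem Omega_lower_bound (n : ℕ) (hn : 3 ≤ n) (t : SimpleGraph (Fin n))
    (ht : t.IsTree) (π : Equiv.Perm (Fin n)) :
    -((5 * (n : ℚ) - 8 - 5 * ((n % 2 : ℕ) : ℚ)) / ((n : ℚ) + 2 - ((n % 2 : ℕ) : ℚ)))
      ≤ Omega t π := by
  have h1 := cost_le hn t ht π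
  have h2 := Dmin_le hn t ht
  have hnq : (3 : ℚ) ≤ n := by exact_mod_cast hn
  unfold Omega Drla
  generalize cost t π = D at *
  generalize Dmin t = M at *
  rcases Nat.mod_two_eq_zero_or_one n with hr | hr
  · have e : (n - 1) % 2 = 1 := by omega
    have hn4 : (4 : ℚ) ≤ n := by
      have : 4 ≤ n := by omega
      exact_mod_cast this
    rw [e] at h1
    have h1' : 4 * (D : ℚ) ≤ 3 * ((n : ℚ) - 1) ^ 2 + 1 := by exact_mod_cast h1
    have h2' : 4 * (M : ℚ) ≤ (n : ℚ) ^ 2 := by exact_mod_cast h2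
    rw [hr, neg_le_iff_add_nonneg, Nat.cast_zero]
    have hd1 : 0 < ((n : ℚ) ^ 2 - 1) / 3 - M := by nlinarith
    have hd2 : 0 < (n : ℚ) + 2 - 0 := by linarith
    rw [div_add_div _ _ hd1.ne' hd2.ne']
    apply div_nonneg _ (by positivity)
    nlinarith [mul_nonneg hd2.le (sub_nonneg.2 h1'),
      mul_nonneg (show 0 ≤ 5 * (n : ℚ) - 8 by linarith) (sub_nonneg.2 h2')]
  · have e : (n - 1) % 2 = 0 := by omega
    rw [e] at h1
    have h1' : 4 * (D : ℚ) ≤ 3 * ((n : ℚ) - 1) ^ 2 := by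
      have : 4 * (D : ℤ) ≤ 3 * ((n : ℤ) - 1) ^ 2 := by simpa using h1
      exact_mod_cast this
    have h2' : 4 * (M : ℚ) ≤ (n : ℚ) ^ 2 - 1 := by
      have : 4 * (M : ℤ) ≤ (n : ℤ) ^ 2 - 1 := by
        obtain ⟨k, hk⟩ : ∃ k, n = 2 * k + 1 := ⟨n / 2, by omega⟩
        subst hk
        push_cast at h2 ⊢
        ring_nf at h2 ⊢
        omega
      exact_mod_cast this
    rw [hr, neg_le_iff_add_nonneg, Nat.cast_one]
    have hd1 : 0 < ((n : ℚ) ^ 2 - 1) / 3 - M := by nlinarith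
    have hd2 : 0 < (n : ℚ) + 2 - 1 := by linarith
    rw [div_add_div _ _ hd1.ne' hd2.ne']
    apply div_nonneg _ (by positivity)
    nlinarith [mul_nonneg hd2.le (sub_nonneg.2 h1'),
      mul_nonneg (show 0 ≤ 5 * (n : ℚ) - 13 by linarith) (sub_nonneg.2 h2')]
end

section
/- For every integer n ≥ 1, every tree t on n vertices and every linear arrangement π, the cost satisfies 4·D(t,π) ≤ 3(n − 1)² + 1 − (n mod 2); that is, D(t,π) is at most the maximum cost of the balanced bistar tree on n vertices. -/
open Finset

lemma exists_parent_s6 {n : ℕ} (t : SimpleGraph (Fin n)) (ht : t.IsTree) (r v : Fin n)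
    (hv : v ≠ r) : ∃ w, t.Adj v w ∧ t.dist w r < t.dist v r := by
  obtain ⟨p, hp⟩ := ht.connected.exists_walk_length_eq_dist v r
  cases p with
  | nil => exact absurd rfl hv
  | cons h q =>
    refine ⟨_, h, ?_⟩
    rw [← hp, SimpleGraph.Walk.length_cons]
    exact Nat.lt_succ_of_le (SimpleGraph.dist_le q)

/-- Rooting the tree at `r`, the edges are the pairs (vertex, parent). -/
lemma edges_eq_image {n : ℕ} (t : SimpleGraph (Fin n)) [Fintype t.edgeSet] (ht : t.IsTree)
    (r : Fin n) : ∃ p : Fin n → Fin n,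
      Set.InjOn (fun v => s(v, p v)) (({r} : Finset (Fin n))ᶜ : Finset (Fin n)) ∧
      t.edgeFinset = (({r} : Finset (Fin n))ᶜ).image (fun v => s(v, p v)) := by
  have h : ∀ v, ∃ w, v ≠ r → t.Adj v w ∧ t.dist w r < t.dist v r := by
    intro v
    by_cases hv : v = r
    · exact ⟨v, fun h => absurd hv h⟩
    · obtain ⟨w, hw⟩ := exists_parent_s6 t ht r v hv
      exact ⟨w, fun _ => hw⟩
  choose p hp using h
  have hinj : Set.InjOn (fun v => s(v, p v)) (({r} : Finset (Fin n))ᶜ : Finset (Fin n)) := by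
    intro a ha b hb hab
    have ha' : a ≠ r := by simpa using ha
    have hb' : b ≠ r := by simpa using hb
    have h1 := (hp a ha').2
    have h2 := (hp b hb').2
    simp only [Sym2.eq_iff] at hab
    rcases hab with ⟨h, _⟩ | ⟨h3, h4⟩
    · exact h
    · rw [h4] at h1
      rw [← h3] at h2
      omega
  refine ⟨p, hinj, ?_⟩
  symm
  apply Finset.eq_of_subset_of_card_le
  · intro e he
    obtain ⟨v, hv, rfl⟩ := Finset.mem_image.1 he
    simpa using (hp v (by simpa using hv)).1
  · rw [Finset.card_image_of_injOn hinj, Finset.card_compl, Finset.card_singleton]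
    have := ht.card_edgeFinset
    omega

lemma sum_max (m : ℕ) :
    4 * ∑ i ∈ range (m + 1), max i (m - i) + (m + 1) % 2 = 3 * m ^ 2 + 4 * m + 1 := by
  induction m using Nat.twoStepInduction with
  | zero => simp
  | one => simp [Finset.sum_range_succ]
  | more m ih _ =>
    have h : ∑ i ∈ range (m + 2 + 1), max i (m + 2 - i)
        = ∑ i ∈ range (m + 1), max i (m - i) + (m + 1) + 2 * (m + 2) := by
      rw [Finset.sum_range_succ, Finset.sum_range_succ']
      have : ∑ i ∈ range (m + 1), max (i + 1) (m + 2 - (i + 1))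
          = ∑ i ∈ range (m + 1), (max i (m - i) + 1) := by
        apply Finset.sum_congr rfl
        intro i hi
        have := Finset.mem_range.1 hi
        omega
      rw [this, Finset.sum_add_distrib]
      simp
      ring
    rw [h]
    have : (m + 2 + 1) % 2 = (m + 1) % 2 := by omega
    rw [this]
    nlinarith

theorem cost_le_balanced_bistar_max (n : ℕ) (hn : 1 ≤ n) (t : SimpleGraph (Fin n))
    (ht : t.IsTree) (π : Equiv.Perm (Fin n)) :
    (4 * cost t π : ℤ) ≤ 3 * ((n : ℤ) - 1) ^ 2 + 1 - ((n % 2 : ℕ) : ℤ) := by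
  obtain ⟨m, rfl⟩ : ∃ m, n = m + 1 := ⟨n - 1, by omega⟩
  have key : cost t π + m ≤ ∑ i ∈ range (m + 1), max i (m - i) := by
    unfold cost
    letI := Classical.decRel t.Adj
    obtain ⟨p, hinj, he⟩ := edges_eq_image t ht (π.symm 0)
    rw [he, Finset.sum_image hinj]
    have h1 : ∑ i ∈ range (m + 1), max i (m - i)
        = ∑ v : Fin (m + 1), max (π v : ℕ) (m - (π v : ℕ)) := by
      rw [Equiv.sum_comp π (fun v : Fin (m + 1) => max (v : ℕ) (m - (v : ℕ))),
        ← Fin.sum_univ_eq_sum_range (fun i => max i (m - i))]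
    rw [h1, ← Finset.sum_compl_add_sum ({π.symm 0} : Finset (Fin (m + 1)))]
    apply Nat.add_le_add
    · apply Finset.sum_le_sum
      intro v _
      simp only [Sym2.lift_mk]
      have := (π v).isLt
      have := (π (p v)).isLt
      omega
    · simp
  have h2 := sum_max m
  have h3 : 4 * cost t π + (m + 1) % 2 ≤ 3 * m ^ 2 + 1 := by omega
  have h4 : ((4 * cost t π + (m + 1) % 2 : ℕ) : ℤ) ≤ ((3 * m ^ 2 + 1 : ℕ) : ℤ) := by
    exact_mod_cast h3
  push_cast at h4 ⊢
  simp only [add_sub_cancel_right]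
  linarith
end

section
/- For every integer n ≥ 1, the star tree on n vertices (one hub adjacent to the other n − 1 vertices) has minimum cost D_min equal to ⌊n²/4⌋, equivalently (n² − (n mod 2))/4. -/
open Finset

/-- The star tree on `n` vertices with hub `h`: `h` is adjacent to every other
vertex and there are no other edges. -/
def starTree (n : ℕ) (h : Fin n) : SimpleGraph (Fin n) :=
  SimpleGraph.fromRel (fun u _ => u = h)

theorem cost_starTree {n : ℕ} (h : Fin n) (π : Equiv.Perm (Fin n)) :
    cost (starTree n h) π =
      ∑ i ∈ Finset.range n, (((π h : ℕ) : ℤ) - (i : ℤ)).natAbs := by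
  classical
  have h1 : ∑ i ∈ Finset.range n, (((π h : ℕ) : ℤ) - (i : ℤ)).natAbs
      = ∑ v : Fin n, (((π h : ℕ) : ℤ) - ((π v : ℕ) : ℤ)).natAbs := by
    rw [Finset.sum_range]
    exact (Equiv.sum_comp π (fun i : Fin n => (((π h : ℕ) : ℤ) - ((i : ℕ) : ℤ)).natAbs)).symm
  have h2 : ∑ v : Fin n, (((π h : ℕ) : ℤ) - ((π v : ℕ) : ℤ)).natAbs
      = ∑ v ∈ Finset.univ.erase h, (((π h : ℕ) : ℤ) - ((π v : ℕ) : ℤ)).natAbs := by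
    symm
    apply Finset.sum_erase
    simp
  rw [h1, h2]
  unfold cost
  symm
  refine Finset.sum_bij (fun v _ => s(h, v)) ?_ ?_ ?_ ?_
  · intro v hv
    have : v ≠ h := by simpa using hv
    rw [SimpleGraph.mem_edgeFinset, SimpleGraph.mem_edgeSet]
    simp [starTree, this.symm]
  · intro a _ b _ hab
    exact Sym2.congr_right.mp hab
  · intro e
    induction e using Sym2.ind with
    | _ u v =>
      intro he
      rw [SimpleGraph.mem_edgeFinset, SimpleGraph.mem_edgeSet, starTree,
        SimpleGraph.fromRel_adj] at he
      obtain ⟨hne, rfl | rfl⟩ := he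
      · exact ⟨v, by simpa using hne.symm, rfl⟩
      · exact ⟨u, by simpa using hne, Sym2.eq_swap⟩
  · intro v _
    rfl

theorem sum_dist (p m : ℕ) :
    2 * ∑ i ∈ Finset.range (p + m + 1), ((p : ℤ) - (i : ℤ)).natAbs
      = p * (p + 1) + m * (m + 1) := by
  induction m with
  | zero =>
    induction p with
    | zero => simp
    | succ p ih =>
      rw [Finset.sum_range_succ']
      have e : ∀ i : ℕ, (((p + 1 : ℕ) : ℤ) - ((i + 1 : ℕ) : ℤ)).natAbs
          = ((p : ℤ) - (i : ℤ)).natAbs := by intro i; omega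
      have e2 : (((p + 1 : ℕ) : ℤ) - ((0 : ℕ) : ℤ)).natAbs = p + 1 := by omega
      simp only [e, e2]
      simp only [Nat.add_zero] at ih ⊢
      rw [mul_add, ih]
      ring
  | succ m ih =>
    rw [show p + (m + 1) + 1 = (p + m + 1) + 1 by ring, Finset.sum_range_succ, mul_add, ih]
    have e : ((p : ℤ) - ((p + m + 1 : ℕ) : ℤ)).natAbs = m + 1 := by omega
    rw [e]
    ring

theorem sq_div_four (n : ℕ) : n ^ 2 = 4 * (n ^ 2 / 4) + n % 2 := by
  obtain ⟨k, rfl | rfl⟩ := Nat.even_or_odd' n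
  · have : (2 * k) ^ 2 = 4 * k ^ 2 := by ring
    omega
  · have : (2 * k + 1) ^ 2 = 4 * (k ^ 2 + k) + 1 := by ring
    omega

theorem Dmin_starTree (n : ℕ) (hn : 1 ≤ n) (h : Fin n) :
    Dmin (starTree n h) = n ^ 2 / 4 ∧ n ^ 2 / 4 = (n ^ 2 - n % 2) / 4 := by
  have hs := sq_div_four n
  refine ⟨?_, by omega⟩
  unfold Dmin
  apply le_antisymm
  · have hlt : n / 2 < n := by omega
    refine (Finset.inf'_le _ (Finset.mem_univ (Equiv.swap h ⟨n / 2, hlt⟩))).trans ?_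
    rw [cost_starTree, Equiv.swap_apply_left]
    obtain ⟨k, rfl | rfl⟩ := Nat.even_or_odd' n
    · obtain ⟨j, rfl⟩ : ∃ j, k = j + 1 := ⟨k - 1, by omega⟩
      have hd := sum_dist (j + 1) j
      have e1 : 2 * (j + 1) / 2 = j + 1 := by omega
      have e2 : 2 * (j + 1) = j + 1 + j + 1 := by omega
      simp only [e1]
      rw [← e2] at hd
      have : (2 * (j + 1)) ^ 2 = 2 * ((j + 1) * (j + 1 + 1) + j * (j + 1)) := by ring
      omega
    · have hd := sum_dist k k
      have e1 : (2 * k + 1) / 2 = k := by omega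
      have e2 : 2 * k + 1 = k + k + 1 := by omega
      simp only [e1]
      rw [← e2] at hd
      have : (2 * k + 1) ^ 2 = 2 * (k * (k + 1) + k * (k + 1)) + 1 := by ring
      omega
  · apply Finset.le_inf'
    intro π _
    rw [cost_starTree]
    obtain ⟨m, hm⟩ : ∃ m, n = (π h : ℕ) + m + 1 := ⟨n - 1 - (π h : ℕ), by omega⟩
    have hd := sum_dist (π h : ℕ) m
    rw [← hm] at hd
    generalize (π h : ℕ) = p at *
    have key : n ^ 2 ≤ 2 * (p * (p + 1) + m * (m + 1)) + 1 := by
      rw [hm]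
      zify
      nlinarith [sq_nonneg ((p : ℤ) - m)]
    omega
end

section
/- For every integer n ≥ 1 and every tree t on n vertices, the minimum cost satisfies D_min(t) ≤ ⌊n²/4⌋; that is, among all trees on n vertices the star tree maximizes D_min. -/
open Finset

/-- Distance of two natural numbers, as used in `cost`. -/
def ndist (a b : ℕ) : ℕ := ((a : ℤ) - (b : ℤ)).natAbs

lemma ndist_comm (a b : ℕ) : ndist a b = ndist b a := by
  unfold ndist; omega

lemma exists_two_low {n : ℕ} (t : SimpleGraph (Fin n)) [DecidableRel t.Adj] (ht : t.IsAcyclic)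
    (S : Finset (Fin n)) (hS : 2 ≤ #S) :
    ∃ u ∈ S, ∃ v ∈ S, u ≠ v ∧ #(S.filter (t.Adj u)) ≤ 1 ∧ #(S.filter (t.Adj v)) ≤ 1 := by
  classical
  have hnt : Nontrivial (S : Set (Fin n)) := by
    rw [Set.nontrivial_coe_sort]
    exact Finset.one_lt_card_iff_nontrivial.mp hS
  have hac : (t.induce (S : Set (Fin n))).IsAcyclic := ht.induce _
  obtain ⟨T, hT⟩ := (SimpleGraph.connected_top (V := (S : Set (Fin n)))).exists_isTree_le_of_le_of_isAcyclic
    le_top hac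
  obtain ⟨-, hle, hT⟩ : T ≤ ⊤ ∧ t.induce (S : Set (Fin n)) ≤ T ∧ T.IsTree := by tauto
  obtain ⟨u, v, huv, hu, hv⟩ := hT.exists_ne_and_degree_eq_one
  have key : ∀ w : (S : Set (Fin n)), T.degree w = 1 → #(S.filter (t.Adj w)) ≤ 1 := by
    intro w hw
    rw [← hw, ← SimpleGraph.card_neighborFinset_eq_degree]
    rw [← Finset.card_map (Function.Embedding.subtype _) (s := T.neighborFinset w)]
    apply Finset.card_le_card
    intro x hx
    rw [Finset.mem_filter] at hx
    simp only [Finset.mem_map, SimpleGraph.mem_neighborFinset]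
    exact ⟨⟨x, hx.1⟩, hle (by simpa using hx.2), rfl⟩
  exact ⟨u, u.2, v, v.2, fun h => huv (Subtype.ext h), key u hu, key v hv⟩

/-- Twice the cost restricted to `S`. -/
def pcost {n : ℕ} (t : SimpleGraph (Fin n)) [DecidableRel t.Adj] (S : Finset (Fin n))
    (f : Fin n → ℕ) : ℕ :=
  ∑ u ∈ S, ∑ v ∈ S, if t.Adj u v then ndist (f u) (f v) else 0

/-- Cost of the edges between a vertex at position `a` and `S`. -/
def scost {n : ℕ} (t : SimpleGraph (Fin n)) [DecidableRel t.Adj] (S : Finset (Fin n))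
    (f : Fin n → ℕ) (u : Fin n) (a : ℕ) : ℕ :=
  ∑ x ∈ S, if t.Adj u x then ndist a (f x) else 0

lemma pcost_insert {n : ℕ} (t : SimpleGraph (Fin n)) [DecidableRel t.Adj] (S : Finset (Fin n))
    (f : Fin n → ℕ) (u : Fin n) (hu : u ∉ S) :
    pcost t (insert u S) f = pcost t S f + 2 * scost t S f u (f u) := by
  unfold pcost scost
  simp only [Finset.sum_insert hu, Finset.sum_add_distrib, SimpleGraph.irrefl, if_false]
  have : ∀ x, (if t.Adj x u then ndist (f x) (f u) else 0) =
      if t.Adj u x then ndist (f u) (f x) else 0 := by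
    intro x
    simp only [t.adj_comm x u, ndist_comm (f x)]
  simp only [this]
  omega

lemma scost_pair {n : ℕ} (t : SimpleGraph (Fin n)) [DecidableRel t.Adj] (S : Finset (Fin n))
    (f : Fin n → ℕ) (u : Fin n) (m : ℕ) (hf : ∀ x ∈ S, f x ≤ m) :
    scost t S f u 0 + scost t S f u m = #(S.filter (t.Adj u)) * m := by
  unfold scost
  rw [← Finset.sum_add_distrib, Finset.card_filter, Finset.sum_mul]
  refine Finset.sum_congr rfl fun x hx => ?_
  have := hf x hx
  split_ifs
  · unfold ndist; omega
  · simp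

lemma scost_congr {n : ℕ} (t : SimpleGraph (Fin n)) [DecidableRel t.Adj] (S : Finset (Fin n))
    (f g : Fin n → ℕ) (u : Fin n) (a : ℕ) (h : ∀ x ∈ S, f x = g x) :
    scost t S f u a = scost t S g u a := by
  unfold scost
  exact Finset.sum_congr rfl fun x hx => by rw [h x hx]

lemma pcost_shift {n : ℕ} (t : SimpleGraph (Fin n)) [DecidableRel t.Adj] (S : Finset (Fin n))
    (f g : Fin n → ℕ) (h : ∀ x ∈ S, g x = f x + 1) :
    pcost t S g = pcost t S f := by
  unfold pcost
  refine Finset.sum_congr rfl fun x hx => Finset.sum_congr rfl fun y hy => ?_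
  rw [h x hx, h y hy]
  unfold ndist
  split_ifs <;> omega

lemma place {n : ℕ} (t : SimpleGraph (Fin n)) [DecidableRel t.Adj] (S : Finset (Fin n))
    (f : Fin n → ℕ) (u v : Fin n) (hu : u ∉ S) (hv : v ∉ S) (huv : u ≠ v)
    (hinj : Set.InjOn f S) (hlt : ∀ x ∈ S, f x < #S) :
    ∃ g : Fin n → ℕ, Set.InjOn g (insert u (insert v S) : Finset (Fin n)) ∧
      (∀ x ∈ insert u (insert v S), g x < #S + 2) ∧
      pcost t (insert u (insert v S)) g = pcost t S f +
        2 * (scost t S (fun x => f x + 1) u 0 + scost t S (fun x => f x + 1) v (#S + 1) +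
          if t.Adj u v then #S + 1 else 0) := by
  classical
  let g : Fin n → ℕ := fun x => if x = u then 0 else if x = v then #S + 1 else f x + 1
  have gu : g u = 0 := by simp [g]
  have gv : g v = #S + 1 := by simp [g, huv.symm]
  have gS : ∀ x ∈ S, g x = f x + 1 := by
    intro x hx
    have h1 : x ≠ u := fun h => hu (h ▸ hx)
    have h2 : x ≠ v := fun h => hv (h ▸ hx)
    simp [g, h1, h2]
  refine ⟨g, ?_, ?_, ?_⟩
  · intro x hx y hy hxy
    simp only [Finset.coe_insert, Set.mem_insert_iff, Finset.mem_coe] at hx hy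
    rcases hx with rfl | rfl | hx <;> rcases hy with rfl | rfl | hy
    all_goals first
      | rfl
      | (exfalso; have := gS _ ‹_›; have := hlt _ ‹_›; omega)
      | (exfalso; omega)
      | skip
    have h1 := gS x hx
    have h2 := gS y hy
    exact hinj hx hy (by omega)
  · intro x hx
    simp only [Finset.mem_insert] at hx
    rcases hx with rfl | rfl | hx
    · omega
    · omega
    · have := gS x hx; have := hlt x hx; omega
  · rw [pcost_insert t _ g u (by simp [hu, huv]), pcost_insert t _ g v hv, pcost_shift t S f g gS,
      gu, gv, scost_congr t S g (fun x => f x + 1) v _ gS]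
    have : scost t (insert v S) g u 0 = (if t.Adj u v then #S + 1 else 0) +
        scost t S (fun x => f x + 1) u 0 := by
      rw [← scost_congr t S g (fun x => f x + 1) u _ gS]
      unfold scost
      rw [Finset.sum_insert hv, gv]
      congr 1
    rw [this]; ring

lemma main_ind {n : ℕ} (t : SimpleGraph (Fin n)) [DecidableRel t.Adj] (ht : t.IsAcyclic) :
    ∀ (k : ℕ) (S : Finset (Fin n)), #S = k →
    ∃ f : Fin n → ℕ, Set.InjOn f S ∧ (∀ x ∈ S, f x < k) ∧ pcost t S f ≤ 2 * (k ^ 2 / 4) := by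
  classical
  intro k
  induction k using Nat.strong_induction_on with
  | _ k ih =>
  intro S hS
  by_cases hk : k < 2
  · have hsub : ∀ x ∈ S, ∀ y ∈ S, x = y := Finset.card_le_one.mp (by omega)
    refine ⟨fun _ => 0, fun x hx y hy _ => hsub x hx y hy, ?_, ?_⟩
    · intro x hx
      have := Finset.card_pos.mpr ⟨x, hx⟩
      show 0 < k
      omega
    · simp [pcost, ndist]
  · obtain ⟨u, hu, v, hv, huv, du, dv⟩ := exists_two_low t ht S (by omega)
    obtain ⟨S', hS'⟩ : ∃ S', S' = (S.erase u).erase v := ⟨_, rfl⟩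
    have hu' : u ∉ S' := by simp [hS']
    have hv' : v ∉ S' := by simp [hS']
    have hins : insert u (insert v S') = S := by
      rw [hS', Finset.insert_erase (by simp [hv, huv.symm]), Finset.insert_erase hu]
    have hins' : insert v (insert u S') = S := by rw [Finset.insert_comm, hins]
    have hcard : #S' + 2 = k := by
      rw [← hS, ← hins, Finset.card_insert_of_notMem (by simp [hu', huv]),
        Finset.card_insert_of_notMem hv']
    obtain ⟨f, hinj, hlt, hc⟩ := ih #S' (by omega) S' rfl
    obtain ⟨g1, i1, l1, c1⟩ := place t S' f u v hu' hv' huv hinj hlt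
    obtain ⟨g2, i2, l2, c2⟩ := place t S' f v u hv' hu' huv.symm hinj hlt
    rw [hins] at i1 l1 c1
    rw [hins'] at i2 l2 c2
    rw [hcard] at l1 l2
    have pu := scost_pair t S' (fun x => f x + 1) u (#S' + 1) (fun x hx => by
      have := hlt x hx; omega)
    have pv := scost_pair t S' (fun x => f x + 1) v (#S' + 1) (fun x hx => by
      have := hlt x hx; omega)
    have eu : #(S.filter (t.Adj u)) = #(S'.filter (t.Adj u)) + if t.Adj u v then 1 else 0 := by
      rw [Finset.card_filter, Finset.card_filter, ← hins', Finset.sum_insert (by simp [hv', huv.symm]),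
        Finset.sum_insert hu']
      simp [add_comm]
    have ev : #(S.filter (t.Adj v)) = #(S'.filter (t.Adj v)) + if t.Adj u v then 1 else 0 := by
      rw [Finset.card_filter, Finset.card_filter, ← hins', Finset.sum_insert (by simp [hv', huv.symm]),
        Finset.sum_insert hu']
      simp [add_comm, t.adj_comm]
    have arith : k ^ 2 / 4 = #S' ^ 2 / 4 + (#S' + 1) := by
      rw [← hcard]
      have : (#S' + 2) ^ 2 = #S' ^ 2 + 4 * (#S' + 1) := by ring
      omega
    simp only [t.adj_comm v u] at c2
    have hsum : pcost t S g1 + pcost t S g2 ≤ 4 * (k ^ 2 / 4) := by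
      rw [c1, c2]
      have hd : #(S.filter (t.Adj u)) * (#S' + 1) + #(S.filter (t.Adj v)) * (#S' + 1) ≤
          2 * (#S' + 1) := by nlinarith
      rw [eu, ev] at hd
      split_ifs at hd ⊢ <;> nlinarith
    by_cases h : pcost t S g1 ≤ 2 * (k ^ 2 / 4)
    · exact ⟨g1, i1, l1, h⟩
    · exact ⟨g2, i2, l2, by omega⟩

lemma two_cost {n : ℕ} (t : SimpleGraph (Fin n)) [DecidableRel t.Adj] (π : Equiv.Perm (Fin n)) :
    2 * cost t π = pcost t univ (fun x => (π x : ℕ)) := by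
  classical
  unfold cost pcost
  rw [← Finset.sum_product', ← Finset.sum_filter, Finset.mul_sum]
  rw [← Finset.sum_fiberwise_of_maps_to (t := t.edgeFinset) (g := fun q : Fin n × Fin n => s(q.1, q.2))
    (by intro q hq; simpa using hq)]
  refine Finset.sum_congr (by ext; simp) fun e he => ?_
  induction e using Sym2.ind with
  | _ a b =>
  have hab : t.Adj a b := by simpa using he
  have hfib : ((univ ×ˢ univ).filter (fun q : Fin n × Fin n => t.Adj q.1 q.2)).filter
      (fun q => s(q.1, q.2) = s(a, b)) = {(a, b), (b, a)} := by
    ext ⟨x, y⟩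
    simp only [mem_filter, mem_product, mem_univ, true_and, mem_insert, mem_singleton,
      Sym2.eq_iff, Prod.mk.injEq]
    constructor
    · exact fun h => h.2
    · rintro (⟨rfl, rfl⟩ | ⟨rfl, rfl⟩)
      · exact ⟨hab, Or.inl ⟨rfl, rfl⟩⟩
      · exact ⟨hab.symm, Or.inr ⟨rfl, rfl⟩⟩
  rw [hfib, Finset.sum_pair (by simp [hab.ne])]
  simp only [Sym2.lift_mk, ndist]
  omega

theorem Dmin_le_star_Dmin (n : ℕ) (hn : 1 ≤ n) (t : SimpleGraph (Fin n))
    (ht : t.IsTree) :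
    Dmin t ≤ n ^ 2 / 4 := by
  classical
  obtain ⟨f, hinj, hlt, hc⟩ := main_ind t ht.isAcyclic n univ (by simp)
  let p : Fin n → Fin n := fun x => ⟨f x, hlt x (mem_univ x)⟩
  have hp : Function.Injective p := by
    intro x y h
    exact hinj (by simp) (by simp) (by simpa [p] using h)
  let π : Equiv.Perm (Fin n) := Equiv.ofBijective p (Finite.injective_iff_bijective.mp hp)
  have h2 := two_cost t π
  have h3 : pcost t univ (fun x => (π x : ℕ)) = pcost t univ f := rfl
  have h4 : Dmin t ≤ cost t π := Finset.inf'_le _ (mem_univ π)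
  omega
end

section
/- For every integer n ≥ 2 and every tree t on n vertices, the expected value of Γ under a uniformly random linear arrangement, which equals D_rla(n)/D_min(t) = ((n² − 1)/3)/D_min(t), satisfies (4/3)·(n² − 1)/(n² − (n mod 2)) ≤ D_rla(n)/D_min(t) ≤ (n + 1)/3, the lower bound being attained by the star tree and the upper bound by the linear tree (path). -/
open Finset

theorem cost_eq_pairs {n : ℕ} (t : SimpleGraph (Fin n)) (π : Equiv.Perm (Fin n)) :
    cost t π = letI := Classical.decRel t.Adj
      ∑ x ∈ (univ : Finset (Fin n × Fin n)).filter
        (fun x => t.Adj x.1 x.2 ∧ π x.1 < π x.2), ((π x.2 : ℕ) - (π x.1 : ℕ)) := by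
  classical
  unfold cost
  symm
  refine Finset.sum_bij (fun x _ => s(x.1, x.2)) ?_ ?_ ?_ ?_
  · rintro ⟨a, b⟩ hx
    simp at hx
    simp [hx.1]
  · rintro ⟨a, b⟩ hx ⟨c, d⟩ hy hxy
    simp at hx hy hxy
    rcases hxy with ⟨rfl, rfl⟩ | ⟨rfl, rfl⟩
    · rfl
    · exact absurd hx.2 (not_lt.mpr hy.2.le)
  · intro e
    induction e using Sym2.ind with
    | _ a b =>
      intro he
      simp at he
      rcases lt_trichotomy (π a) (π b) with h | h | h
      · exact ⟨(a, b), by simp [he, h], rfl⟩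
      · exact absurd (π.injective h) he.ne
      · exact ⟨(b, a), by simp [he.symm, h], Sym2.eq_swap⟩
  · rintro ⟨a, b⟩ hx
    simp only [Finset.mem_filter, Finset.mem_univ, true_and, Fin.lt_def] at hx
    simp only [Sym2.lift_mk]
    omega

open Classical in
/-- Ordered pairs of adjacent vertices crossing the gap before position `j`. -/
noncomputable def cutSet {V : Type} [Fintype V] (G : SimpleGraph V) (p : V → ℕ) (j : ℕ) :
    Finset (V × V) :=
  (univ : Finset (V × V)).filter (fun x => G.Adj x.1 x.2 ∧ p x.1 < j ∧ j ≤ p x.2)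

theorem cost_eq_cuts {n : ℕ} (t : SimpleGraph (Fin n)) (π : Equiv.Perm (Fin n)) :
    cost t π = ∑ j ∈ range n, (cutSet t (fun v => (π v : ℕ)) j).card := by
  classical
  rw [cost_eq_pairs]
  have h1 : ∀ j, (cutSet t (fun v => (π v : ℕ)) j).card =
      ∑ x ∈ (univ : Finset (Fin n × Fin n)).filter (fun x => t.Adj x.1 x.2 ∧ π x.1 < π x.2),
        if ((π x.1 : ℕ) < j ∧ j ≤ (π x.2 : ℕ)) then 1 else 0 := by
    intro j
    rw [← Finset.card_filter, Finset.filter_filter]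
    unfold cutSet
    congr 1
    ext x
    simp only [Finset.mem_filter, Finset.mem_univ, true_and, Fin.lt_def]
    constructor
    · rintro ⟨h, h1, h2⟩
      exact ⟨⟨h, by omega⟩, h1, h2⟩
    · rintro ⟨⟨h, _⟩, h1, h2⟩
      exact ⟨h, h1, h2⟩
  simp only [h1]
  rw [Finset.sum_comm]
  refine Finset.sum_congr (by congr) ?_
  intro x _
  rw [← Finset.card_filter]
  have : (range n).filter (fun j => (π x.1 : ℕ) < j ∧ j ≤ (π x.2 : ℕ))
      = Finset.Ioc (π x.1 : ℕ) (π x.2 : ℕ) := by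
    ext j
    have := (π x.2).2
    simp
    omega
  rw [this, Nat.card_Ioc]

theorem exists_arr_s12 (n : ℕ) : ∀ (V : Type) [Fintype V] (G : SimpleGraph V), Fintype.card V = n →
    G.IsTree → ∃ p : V → ℕ, Function.Injective p ∧ (∀ v, p v < n) ∧
      ∀ j, (cutSet G p j).card ≤ j ∧ (cutSet G p j).card ≤ n - j := by
  classical
  induction n with
  | zero =>
    intro V _ G hV hG
    have := hG.1.nonempty
    exact absurd hV Fintype.card_ne_zero
  | succ n ih =>
    intro V _ G hV hG
    rcases Nat.eq_zero_or_pos n with rfl | hn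
    · have hs : Subsingleton V := Fintype.card_le_one_iff_subsingleton.mp (by omega)
      refine ⟨fun _ => 0, fun a b _ => Subsingleton.elim a b, by simp, fun j => ?_⟩
      have : cutSet G (fun _ => 0) j = ∅ := by
        ext x
        simp [cutSet]
        intro _ h
        omega
      simp [this]
    have hnt : Nontrivial V := Fintype.one_lt_card_iff_nontrivial.mp (by omega)
    obtain ⟨w, hw⟩ := hG.exists_vert_degree_one_of_nontrivial
    obtain ⟨v, hv, huniq⟩ := SimpleGraph.degree_eq_one_iff_existsUnique_adj.mp hw
    have hT : (G.induce {w}ᶜ).IsTree :=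
      ⟨hG.1.induce_compl_singleton_of_degree_eq_one hw, hG.2.induce _⟩
    have hcard : Fintype.card ({w}ᶜ : Set V) = n := by
      rw [Fintype.card_compl_set]; simp; omega
    obtain ⟨p, hinj, hlt, hcut⟩ := ih ({w}ᶜ : Set V) (G.induce {w}ᶜ) hcard hT
    have hvw : v ∈ ({w}ᶜ : Set V) := by simpa using hv.ne'
    obtain ⟨i, hi⟩ : ∃ i, p ⟨v, hvw⟩ = i := ⟨_, rfl⟩
    have hin : i < n := hi ▸ hlt _
    obtain ⟨q, hq⟩ : ∃ q, (q = i ∧ 2 * i + 1 ≤ n) ∨ (q = i + 1 ∧ n ≤ 2 * i + 1) := by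
      rcases le_total (2 * i + 1) n with h | h
      · exact ⟨i, Or.inl ⟨rfl, h⟩⟩
      · exact ⟨i + 1, Or.inr ⟨rfl, h⟩⟩
    let p' : V → ℕ := fun x => if h : x ∈ ({w}ᶜ : Set V) then
      (if p ⟨x, h⟩ < q then p ⟨x, h⟩ else p ⟨x, h⟩ + 1) else q
    have hpw : p' w = q := by simp [p']
    have hpx : ∀ x : ({w}ᶜ : Set V), p' x = if p x < q then p x else p x + 1 := by
      rintro ⟨x, hx⟩
      simp only [p', dif_pos hx]
    have hcases : ∀ x : V, x = w ∨ ∃ y : ({w}ᶜ : Set V), x = y := by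
      intro x
      by_cases h : x = w
      · exact Or.inl h
      · exact Or.inr ⟨⟨x, by simpa using h⟩, rfl⟩
    have hmain : ∀ j, (cutSet G p' j).card ≤
        (cutSet (G.induce {w}ᶜ) p (if j ≤ q then j else j - 1)).card
          + (if j = i + 1 then 1 else 0) := by
      intro j
      let A : Finset (V × V) := (cutSet (G.induce {w}ᶜ) p (if j ≤ q then j else j - 1)).image
        (fun x => ((x.1 : V), (x.2 : V)))
      let B : Finset (V × V) := if j = i + 1 then {if q = i then (w, v) else (v, w)} else ∅
      have hB : B.card = if j = i + 1 then 1 else 0 := by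
        simp only [B]; split_ifs <;> simp
      have hsub : cutSet G p' j ⊆ A ∪ B := by
        rintro ⟨a, b⟩ hx
        simp only [cutSet, Finset.mem_filter, Finset.mem_univ, true_and] at hx
        obtain ⟨hab, ha, hb⟩ := hx
        have hpv := hpx ⟨v, hvw⟩
        rw [hi] at hpv
        simp only at hpv
        rw [Finset.mem_union]
        rcases hcases a with rfl | ⟨a', rfl⟩
        · right
          obtain rfl := huniq b hab
          rw [hpw] at ha
          rw [hpv] at hb
          have h1 : q = i := by
            rcases hq with hq | hq
            · exact hq.1
            · split_ifs at hb <;> omega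
          have h2 : j = i + 1 := by split_ifs at hb <;> omega
          simp [B, h1, h2]
        · rcases hcases b with rfl | ⟨b', rfl⟩
          · right
            obtain rfl := huniq _ hab.symm
            rw [hpw] at hb
            rw [hpv] at ha
            have h1 : q ≠ i := by
              rintro rfl
              split_ifs at ha <;> omega
            have h2 : j = i + 1 := by split_ifs at ha <;> omega
            simp [B, h1, h2]
          · left
            rw [Finset.mem_image]
            refine ⟨(a', b'), ?_, rfl⟩
            rw [hpx] at ha hb
            simp only [cutSet, Finset.mem_filter, Finset.mem_univ, true_and]
            refine ⟨hab, ?_, ?_⟩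
            · split_ifs at ha ⊢ <;> omega
            · split_ifs at hb ⊢ <;> omega
      calc _ ≤ (A ∪ B).card := Finset.card_le_card hsub
        _ ≤ A.card + B.card := Finset.card_union_le _ _
        _ ≤ _ := by rw [hB]; exact Nat.add_le_add_right Finset.card_image_le _
    refine ⟨p', ?_, ?_, ?_⟩
    · intro a b hab
      rcases hcases a with rfl | ⟨a', rfl⟩ <;> rcases hcases b with rfl | ⟨b', rfl⟩
      · rfl
      · rw [hpw, hpx] at hab
        split_ifs at hab <;> omega
      · rw [hpw, hpx] at hab
        split_ifs at hab <;> omega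
      · rw [hpx, hpx] at hab
        have : p a' = p b' := by split_ifs at hab <;> omega
        rw [hinj this]
    · intro x
      rcases hcases x with rfl | ⟨y, rfl⟩
      · rw [hpw]; omega
      · rw [hpx]
        have := hlt y
        split_ifs <;> omega
    · intro j
      have h1 := hmain j
      have h2 := hcut (if j ≤ q then j else j - 1)
      split_ifs at h1 h2 <;> omega

theorem sum_min (n : ℕ) : 4 * ∑ j ∈ range n, min j (n - j) + n % 2 = n ^ 2 := by
  induction n using Nat.strong_induction_on with
  | _ n ih =>
    match n, ih with
    | 0, _ => simp
    | 1, _ => simp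
    | n + 2, ih =>
      have h := ih n (by omega)
      rw [Finset.sum_range_succ, Finset.sum_range_succ']
      have : ∑ k ∈ range n, min (k + 1) (n + 2 - (k + 1)) = ∑ k ∈ range n, (min k (n - k) + 1) := by
        refine Finset.sum_congr rfl fun k hk => ?_
        have := Finset.mem_range.mp hk
        omega
      rw [this, Finset.sum_add_distrib]
      simp only [Finset.sum_const, Finset.card_range, smul_eq_mul, mul_one]
      have e1 : min (n + 1) (n + 2 - (n + 1)) = 1 := by omega
      have e2 : min 0 (n + 2 - 0) = 0 := by omega
      rw [e1, e2]
      have : (n + 2) % 2 = n % 2 := by omega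
      rw [this]
      nlinarith

theorem Dmin_upper {n : ℕ} (t : SimpleGraph (Fin n)) (ht : t.IsTree) :
    4 * Dmin t + n % 2 ≤ n ^ 2 := by
  obtain ⟨p, hinj, hlt, hcut⟩ := exists_arr_s12 n (Fin n) t (by simp) ht
  let f : Fin n → Fin n := fun v => ⟨p v, hlt v⟩
  have hf : Function.Injective f := fun a b h => hinj (by simpa [f] using h)
  let π : Equiv.Perm (Fin n) := Equiv.ofBijective f (Finite.injective_iff_bijective.mp hf)
  have h1 : Dmin t ≤ cost t π := Finset.inf'_le _ (Finset.mem_univ π)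
  have h2 : cost t π ≤ ∑ j ∈ range n, min j (n - j) := by
    rw [cost_eq_cuts]
    refine Finset.sum_le_sum fun j _ => ?_
    exact le_min (hcut j).1 (hcut j).2
  have := sum_min n
  omega

theorem Dmin_lower {n : ℕ} (t : SimpleGraph (Fin n)) (ht : t.Connected) :
    n ≤ Dmin t + 1 := by
  classical
  obtain ⟨π, -, hπ⟩ := Finset.exists_mem_eq_inf' (Finset.univ_nonempty) (cost t)
  have h0 : Dmin t = cost t π := hπ
  rw [h0]
  have hc := ht.card_vert_le_card_edgeSet_add_one
  rw [Nat.card_eq_fintype_card, Nat.card_eq_fintype_card, Fintype.card_fin,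
    ← SimpleGraph.edgeFinset_card] at hc
  refine hc.trans (Nat.add_le_add_right ?_ 1)
  unfold cost
  rw [Finset.card_eq_sum_ones]
  refine (Finset.sum_le_sum (f := fun _ => 1) ?_).trans (le_of_eq (Finset.sum_congr (by congr) fun _ _ => rfl))
  intro e
  induction e using Sym2.ind with
  | _ a b =>
    intro he
    simp at he
    have : (π a : ℕ) ≠ π b := fun h => he.ne (π.injective (Fin.ext h))
    simp only [Sym2.lift_mk]
    omega

theorem Dmin_path {n : ℕ} (hn : 2 ≤ n) : Dmin (SimpleGraph.pathGraph n) + 1 = n := by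
  classical
  apply le_antisymm
  · have h1 : Dmin (SimpleGraph.pathGraph n) ≤ cost (SimpleGraph.pathGraph n) 1 :=
      Finset.inf'_le _ (Finset.mem_univ _)
    have h2 : cost (SimpleGraph.pathGraph n) 1 ≤ n - 1 := by
      rw [cost_eq_pairs]
      rw [Finset.sum_congr rfl (g := fun _ => 1)]
      · rw [← Finset.card_eq_sum_ones]
        conv_rhs => rw [← Finset.card_range (n - 1)]
        refine Finset.card_le_card_of_injOn (fun x => (x.1 : ℕ)) ?_ ?_
        · rintro ⟨a, b⟩ hx
          simp [SimpleGraph.pathGraph_adj] at hx ⊢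
          have h' := Fin.lt_def.mp hx.2
          omega
        · rintro ⟨a, b⟩ hx ⟨c, d⟩ hy hxy
          simp [SimpleGraph.pathGraph_adj, Fin.ext_iff] at hx hy hxy ⊢
          have h1 := Fin.lt_def.mp hx.2
          have h2 := Fin.lt_def.mp hy.2
          omega
      · rintro ⟨a, b⟩ hx
        simp [SimpleGraph.pathGraph_adj] at hx ⊢
        have h' := Fin.lt_def.mp hx.2
        omega
    omega
  · obtain ⟨m, rfl⟩ : ∃ m, n = m + 1 := ⟨n - 1, by omega⟩
    exact Dmin_lower _ (SimpleGraph.pathGraph_connected m)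

theorem sum_abs (i r : ℕ) :
    2 * ∑ k ∈ range (i + 1 + r), ((k : ℤ) - (i : ℤ)).natAbs = i * (i + 1) + r * (r + 1) := by
  induction r with
  | zero =>
    induction i with
    | zero => simp
    | succ i ih =>
      rw [Nat.add_zero, Finset.sum_range_succ']
      have : ∀ k : ℕ, (((k + 1 : ℕ) : ℤ) - ((i + 1 : ℕ) : ℤ)).natAbs = ((k : ℤ) - (i : ℤ)).natAbs := by
        intro k; omega
      simp only [this]
      have h2 : (((0 : ℕ) : ℤ) - ((i + 1 : ℕ) : ℤ)).natAbs = i + 1 := by omega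
      rw [h2]
      rw [Nat.add_zero] at ih
      rw [mul_add, ih]
      ring
  | succ r ih =>
    rw [← Nat.add_assoc, Finset.sum_range_succ, mul_add, ih]
    have : (((i + 1 + r : ℕ) : ℤ) - (i : ℤ)).natAbs = r + 1 := by omega
    rw [this]
    ring

theorem cost_star {n : ℕ} (h : Fin n) (π : Equiv.Perm (Fin n)) :
    cost (starTree n h) π = ∑ k ∈ range n, ((k : ℤ) - ((π h : ℕ) : ℤ)).natAbs := by
  classical
  rw [← Fin.sum_univ_eq_sum_range (fun k => ((k : ℤ) - ((π h : ℕ) : ℤ)).natAbs) n]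
  rw [← Equiv.sum_comp π (fun k : Fin n => (((k : ℕ) : ℤ) - ((π h : ℕ) : ℤ)).natAbs)]
  rw [← Finset.sum_erase (s := univ) (a := h) (by simp)]
  unfold cost
  symm
  refine Finset.sum_bij (fun x _ => s(x, h)) ?_ ?_ ?_ ?_
  · intro a ha
    simp at ha
    rw [SimpleGraph.mem_edgeFinset, SimpleGraph.mem_edgeSet]
    simp [starTree, ha]
  · intro a _ b _ hab
    simp at hab
    rcases hab with hab | hab
    · exact hab
    · rw [hab.1, hab.2]
  · intro e
    induction e using Sym2.ind with
    | _ a b =>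
      intro he
      rw [SimpleGraph.mem_edgeFinset, SimpleGraph.mem_edgeSet] at he
      simp [starTree] at he
      rcases he with ⟨hne, rfl | rfl⟩
      · exact ⟨b, by simp [Ne.symm hne], Sym2.eq_swap⟩
      · exact ⟨a, by simp [hne], rfl⟩
  · intro a _
    simp only [Sym2.lift_mk]

theorem Dmin_star {n : ℕ} (h : Fin n) : 4 * Dmin (starTree n h) + n % 2 = n ^ 2 := by
  have key : ∀ π : Equiv.Perm (Fin n), ∃ r : ℕ, n = (π h : ℕ) + 1 + r ∧
      2 * cost (starTree n h) π = (π h : ℕ) * ((π h : ℕ) + 1) + r * (r + 1) := by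
    intro π
    have hlt := (π h).2
    obtain ⟨r, hr⟩ : ∃ r, n = (π h : ℕ) + 1 + r := ⟨n - ((π h : ℕ) + 1), by omega⟩
    refine ⟨r, hr, ?_⟩
    rw [cost_star, ← sum_abs]
    congr 2
    rw [← hr]
  apply le_antisymm
  · have hpos : 0 < n := h.pos
    let m : Fin n := ⟨n / 2, by omega⟩
    have h1 : Dmin (starTree n h) ≤ cost (starTree n h) (Equiv.swap h m) :=
      Finset.inf'_le _ (Finset.mem_univ _)
    obtain ⟨r, hr, hc⟩ := key (Equiv.swap h m)
    have hm : ((Equiv.swap h m h : Fin n) : ℕ) = n / 2 := by simp [m]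
    rw [hm] at hr hc
    rcases Nat.even_or_odd' n with ⟨k, hk | hk⟩
    · have e : n / 2 = k := by omega
      rw [e] at hr hc
      have e2 : n % 2 = 0 := by omega
      have e3 : k = r + 1 := by omega
      have e4 : n ^ 2 = (2 * k) ^ 2 := by rw [hk]
      rw [e2, e4]
      clear_value m
      generalize cost (starTree n h) (Equiv.swap h m) = c at h1 hc
      generalize Dmin (starTree n h) = D at h1 ⊢
      subst e3
      nlinarith
    · have e : n / 2 = k := by omega
      rw [e] at hr hc
      have e2 : n % 2 = 1 := by omega
      have e3 : k = r := by omega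
      have e4 : n ^ 2 = (2 * k + 1) ^ 2 := by rw [hk]
      rw [e2, e4]
      clear_value m
      generalize cost (starTree n h) (Equiv.swap h m) = c at h1 hc
      generalize Dmin (starTree n h) = D at h1 ⊢
      subst e3
      nlinarith
  · obtain ⟨π, -, hπ⟩ := Finset.exists_mem_eq_inf' (Finset.univ_nonempty) (cost (starTree n h))
    have h0 : Dmin (starTree n h) = cost (starTree n h) π := hπ
    obtain ⟨r, hr, hc⟩ := key π
    rw [h0]
    generalize (π h : ℕ) = i at hr hc
    generalize cost (starTree n h) π = c at hc
    rcases Nat.even_or_odd' n with ⟨k, hk | hk⟩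
    · have e2 : n % 2 = 0 := by omega
      rw [e2]
      have hne : i ≠ r := by omega
      rw [hr]
      rcases Nat.lt_or_gt_of_ne hne with hl | hl
      · obtain ⟨d, rfl⟩ : ∃ d, r = i + 1 + d := ⟨r - (i + 1), by omega⟩
        nlinarith
      · obtain ⟨d, rfl⟩ : ∃ d, i = r + 1 + d := ⟨i - (r + 1), by omega⟩
        nlinarith
    · have e2 : n % 2 = 1 := by omega
      rw [e2]
      rw [hr]
      zify at hc ⊢
      nlinarith [sq_nonneg ((i : ℤ) - r)]

theorem expected_Gamma_bounds (n : ℕ) (hn : 2 ≤ n) (t : SimpleGraph (Fin n))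
    (ht : t.IsTree) :
    (4 / 3) * (((n : ℚ) ^ 2 - 1) / ((n : ℚ) ^ 2 - ((n % 2 : ℕ) : ℚ)))
        ≤ Drla n / (Dmin t : ℚ) ∧
    Drla n / (Dmin t : ℚ) ≤ ((n : ℚ) + 1) / 3 ∧
    (∀ h : Fin n, Drla n / (Dmin (starTree n h) : ℚ)
        = (4 / 3) * (((n : ℚ) ^ 2 - 1) / ((n : ℚ) ^ 2 - ((n % 2 : ℕ) : ℚ)))) ∧
    Drla n / (Dmin (SimpleGraph.pathGraph n) : ℚ) = ((n : ℚ) + 1) / 3 := by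
  have hn' : (2 : ℚ) ≤ n := by exact_mod_cast hn
  have hsq : (0 : ℚ) < (n : ℚ) ^ 2 - 1 := by nlinarith
  have hlow := Dmin_lower t ht.1
  have hup := Dmin_upper t ht
  have hDpos : (0 : ℚ) < (Dmin t : ℚ) := by
    have : 0 < Dmin t := by omega
    exact_mod_cast this
  have hlow' : (n : ℚ) ≤ Dmin t + 1 := by exact_mod_cast hlow
  have hup' : 4 * (Dmin t : ℚ) + ((n % 2 : ℕ) : ℚ) ≤ (n : ℚ) ^ 2 := by exact_mod_cast hup
  have hform : ∀ D : ℚ, (4 / 3) * (((n : ℚ) ^ 2 - 1) / (4 * D)) = Drla n / D := by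
    intro D
    unfold Drla
    rcases eq_or_ne D 0 with rfl | hD
    · simp
    · field_simp
  refine ⟨?_, ?_, ?_, ?_⟩
  · rw [← hform]
    gcongr
    linarith
  · rw [div_le_iff₀ hDpos]
    unfold Drla
    nlinarith
  · intro h
    have hs : 4 * (Dmin (starTree n h) : ℚ) + ((n % 2 : ℕ) : ℚ) = (n : ℚ) ^ 2 := by
      exact_mod_cast Dmin_star h
    rw [← hform, ← hs, add_sub_cancel_right]
  · have hp : (Dmin (SimpleGraph.pathGraph n) : ℚ) + 1 = n := by
      exact_mod_cast Dmin_path hn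
    have hp' : (Dmin (SimpleGraph.pathGraph n) : ℚ) = n - 1 := by linarith
    rw [hp']
    have : (n : ℚ) - 1 ≠ 0 := by linarith
    unfold Drla
    field_simp
    ring
end

section
/- For all integers k ≥ 0 and z ≥ 2k, the maximum, over all injections π from the vertex set of a 1-regular graph with k edges (a perfect matching on 2k vertices) into Fin z, of the sum over its edges {u,v} of |π(u) − π(v)|, equals k(z − k). -/
open Finset

/-- Cost of an injective arrangement `π` of the graph `g` into `z` positions:
the sum over the edges of `g` of the distance between the positions of
their endpoints. -/
noncomputable def icost {m z : ℕ} (g : SimpleGraph (Fin m)) (π : Fin m ↪ Fin z) : ℕ :=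
  letI := Classical.decRel g.Adj
  ∑ e ∈ g.edgeFinset,
    Sym2.lift ⟨fun u v => (((π u : ℕ) : ℤ) - ((π v : ℕ) : ℤ)).natAbs,
      fun u v => by dsimp only; omega⟩ e

lemma edge_sum {m : ℕ} (g : SimpleGraph (Fin m)) [Fintype g.edgeSet] (p : Fin m → Fin m)
    (hp : ∀ v u, g.Adj v u ↔ u = p v) (f : Sym2 (Fin m) → ℕ) :
    ∑ e ∈ g.edgeFinset, f e = ∑ v ∈ univ.filter (fun v => v < p v), f s(v, p v) := by
  have hpp : ∀ v, p (p v) = v := fun v =>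
    ((hp _ _).1 ((hp v (p v)).2 rfl).symm).symm
  symm
  refine Finset.sum_nbij (fun v => s(v, p v)) ?_ ?_ ?_ (fun _ _ => rfl)
  · intro v _
    rw [SimpleGraph.mem_edgeFinset, SimpleGraph.mem_edgeSet]
    exact (hp _ _).2 rfl
  · intro v hv w hw h
    simp only [coe_filter, mem_univ, true_and, Set.mem_ofPred_eq] at hv hw
    simp only [Sym2.eq_iff] at h
    rcases h with h | h
    · exact h.1
    · rw [h.2] at hv
      rw [← h.1] at hw
      exact absurd hv hw.asymm
  · intro e
    induction e using Sym2.ind with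
    | _ a b =>
      intro h
      rw [Finset.mem_coe, SimpleGraph.mem_edgeFinset, SimpleGraph.mem_edgeSet] at h
      have hne := h.ne
      have hb := (hp _ _).1 h
      rcases lt_or_gt_of_ne hne with hl | hl
      · exact ⟨a, by simpa [← hb] using hl, by simp [← hb]⟩
      · have ha : p b = a := by rw [hb, hpp]
        exact ⟨b, by simpa [ha] using hl, by simp [ha, Sym2.eq_swap]⟩

lemma vertex_sum {m : ℕ} (p : Fin m → Fin m) (hpp : ∀ v, p (p v) = v)
    (hne : ∀ v, p v ≠ v) (w : Fin m → ℕ) :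
    ∑ v ∈ univ.filter (fun v => v < p v), (w v + w (p v)) = ∑ v, w v := by
  rw [Finset.sum_add_distrib, ← Finset.sum_filter_add_sum_filter_not univ (fun v => v < p v) w]
  congr 1
  refine Finset.sum_nbij' p p ?_ ?_ ?_ ?_ ?_
  · intro v hv
    simp only [mem_filter, mem_univ, true_and, hpp, not_lt] at hv ⊢
    exact hv.le
  · intro v hv
    simp only [mem_filter, mem_univ, true_and, hpp, not_lt] at hv ⊢
    exact lt_of_le_of_ne hv (hne v)
  · intro v _; exact hpp v
  · intro v _; exact hpp v
  · intro v _; rfl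

lemma odd_sum (k : ℕ) : ∑ i ∈ range k, (2 * i + 1) = k * k := by
  induction k with
  | zero => rfl
  | succ n ih => rw [sum_range_succ, ih]; ring

lemma excess_sum (k t : ℕ) :
    ∑ x ∈ range (k + t + k), ((2 * (x : ℤ) - ((k + t + k : ℕ) : ℤ) + 1).natAbs - t) =
      2 * (k * k) := by
  rw [sum_range_add, sum_range_add, two_mul]
  have h1 : ∑ x ∈ range k, ((2 * (x : ℤ) - ((k + t + k : ℕ) : ℤ) + 1).natAbs - t) = k * k := by
    rw [← odd_sum, ← sum_range_reflect]
    refine sum_congr rfl fun x hx => ?_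
    rw [mem_range] at hx
    omega
  have h2 : ∑ x ∈ range t,
      ((2 * ((k + x : ℕ) : ℤ) - ((k + t + k : ℕ) : ℤ) + 1).natAbs - t) = 0 := by
    refine sum_eq_zero fun x hx => ?_
    rw [mem_range] at hx
    omega
  have h3 : ∑ x ∈ range k,
      ((2 * ((k + t + x : ℕ) : ℤ) - ((k + t + k : ℕ) : ℤ) + 1).natAbs - t) = k * k := by
    rw [← odd_sum]
    refine sum_congr rfl fun x hx => ?_
    rw [mem_range] at hx
    omega
  rw [h1, h2, h3, add_zero]

lemma weight_sum (k t : ℕ) (π : Fin (2 * k) ↪ Fin (k + t + k)) :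
    ∑ v, (2 * ((π v : ℕ) : ℤ) - ((k + t + k : ℕ) : ℤ) + 1).natAbs ≤ 2 * (k * (k + t)) := by
  let F : ℕ → ℕ := fun x => (2 * (x : ℤ) - ((k + t + k : ℕ) : ℤ) + 1).natAbs - t
  have h1 : ∑ v, F (π v) ≤ 2 * (k * k) := by
    rw [← excess_sum k t]
    have : ∑ v, F (π v) = ∑ x ∈ univ.map π, F x := by rw [sum_map]
    rw [this]
    refine (sum_le_sum_of_subset (subset_univ _)).trans ?_
    rw [Fin.sum_univ_eq_sum_range F]
  calc _ ≤ ∑ v, (F (π v) + t) := sum_le_sum fun v _ => by simp only [F]; omega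
    _ = ∑ v, F (π v) + 2 * k * t := by simp [sum_add_distrib]
    _ ≤ _ := by nlinarith

lemma gauss_sum (k t : ℕ) : ∑ i ∈ range k, (k + t + k - 1 - 2 * i) = k * (k + t) := by
  have : ∑ i ∈ range k, (k + t + k - 1 - 2 * i) = ∑ i ∈ range k, ((2 * i + 1) + t) := by
    rw [← sum_range_reflect]
    refine sum_congr rfl fun x hx => ?_
    rw [mem_range] at hx
    omega
  rw [this, sum_add_distrib, odd_sum]
  simp [mul_add]

theorem max_icost_one_regular (k z : ℕ) (hz : 2 * k ≤ z)
    (g : SimpleGraph (Fin (2 * k))) (hg : ∀ v, ∃! u, g.Adj v u) :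
    Finset.univ.sup (fun π : Fin (2 * k) ↪ Fin z => icost g π) = k * (z - k) := by
  classical
  obtain ⟨t, rfl⟩ : ∃ t, z = k + t + k := ⟨z - 2 * k, by omega⟩
  rw [show k + t + k - k = k + t by omega]
  choose p hp1 hp2 using hg
  have hp : ∀ v u, g.Adj v u ↔ u = p v := fun v u =>
    ⟨fun h => hp2 v u h, fun h => h ▸ hp1 v⟩
  have hpp : ∀ v, p (p v) = v := fun v => ((hp _ _).1 (hp1 v).symm).symm
  have hne : ∀ v, p v ≠ v := fun v => (hp1 v).ne'
  have hcost : ∀ π : Fin (2 * k) ↪ Fin (k + t + k), icost g π =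
      ∑ v ∈ univ.filter (fun v => v < p v), (((π v : ℕ) : ℤ) - ((π (p v) : ℕ) : ℤ)).natAbs := by
    intro π
    unfold icost
    rw [edge_sum g p hp]
    rfl
  have hcard : (univ.filter (fun v => v < p v)).card = k := by
    have := vertex_sum p hpp hne (fun _ => 1)
    simp at this
    omega
  apply le_antisymm
  · refine Finset.sup_le fun π _ => ?_
    rw [hcost]
    have h1 := weight_sum k t π
    rw [← vertex_sum p hpp hne] at h1
    have h2 : 2 * ∑ v ∈ univ.filter (fun v => v < p v),
        (((π v : ℕ) : ℤ) - ((π (p v) : ℕ) : ℤ)).natAbs ≤ 2 * (k * (k + t)) := by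
      rw [mul_sum]
      refine le_trans (sum_le_sum fun v _ => ?_) h1
      omega
    omega
  · let e := (univ.filter (fun v => v < p v)).equivFinOfCardEq hcard
    have hmem : ∀ v, ¬ v < p v → p v ∈ univ.filter (fun v => v < p v) := by
      intro v hv
      simp only [mem_filter, mem_univ, true_and, hpp]
      exact lt_of_le_of_ne (not_lt.1 hv) (hne v)
    let q : Fin (2 * k) → Fin (k + t + k) := fun v =>
      if h : v < p v then ⟨e ⟨v, by simpa using h⟩, by omega⟩
      else ⟨k + t + k - 1 - e ⟨p v, hmem v h⟩, by
        have := (e ⟨p v, hmem v h⟩).2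
        omega⟩
    have hq1 : ∀ v (h : v < p v), (q v : ℕ) = e ⟨v, by simpa using h⟩ := by
      intro v h
      simp only [q, dif_pos h]
    have hq2 : ∀ v (h : ¬ v < p v), (q v : ℕ) = k + t + k - 1 - e ⟨p v, hmem v h⟩ := by
      intro v h
      simp only [q, dif_neg h]
    have hinj : Function.Injective q := by
      intro v w hvw
      have hvw := congrArg Fin.val hvw
      by_cases hv : v < p v <;> by_cases hw : w < p w
      · rw [hq1 v hv, hq1 w hw] at hvw
        simpa using e.injective (Fin.ext hvw)
      · rw [hq1 v hv, hq2 w hw] at hvw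
        omega
      · rw [hq2 v hv, hq1 w hw] at hvw
        omega
      · rw [hq2 v hv, hq2 w hw] at hvw
        have : ((e ⟨p v, hmem v hv⟩ : Fin k) : ℕ) = e ⟨p w, hmem w hw⟩ := by omega
        have := e.injective (Fin.ext this)
        simp only [Subtype.mk.injEq] at this
        rw [← hpp v, this, hpp]
    refine le_trans (le_of_eq ?_)
      (Finset.le_sup (f := fun π => icost g π) (mem_univ (⟨q, hinj⟩ : Fin (2 * k) ↪ Fin (k + t + k))))
    simp only [hcost, Function.Embedding.coeFn_mk]
    rw [← gauss_sum, ← Fin.sum_univ_eq_sum_range (fun i => k + t + k - 1 - 2 * i),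
      ← Finset.sum_coe_sort (univ.filter (fun v => v < p v)), ← e.sum_comp]
    refine sum_congr rfl fun v _ => ?_
    obtain ⟨v, hv⟩ := v
    have hv' : v < p v := by simpa using hv
    have hn : ¬ p v < p (p v) := by rw [hpp]; exact hv'.asymm
    have ha := hq1 v hv'
    have hb := hq2 (p v) hn
    simp only [hpp] at hb
    have := (e ⟨v, hv⟩).2
    dsimp only
    rw [ha, hb]
    omega
end

section
/- For all integers m ≥ 0 and z ≥ m + 1, the maximum, over all injections π from the vertex set of the star tree with m edges (a hub adjacent to m leaves) into Fin z, of the sum over its edges {u,v} of |π(u) − π(v)|, equals m(2z − m − 1)/2, and it is attained by placing the hub at one end of the arrangement and the leaves in the positions at the other end. -/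
open Finset

lemma star_cost {m z : ℕ} (π : Fin (m + 1) ↪ Fin z) :
    icost (starTree (m + 1) 0) π
      = ∑ i : Fin m, (((π 0 : ℕ) : ℤ) - ((π i.succ : ℕ) : ℤ)).natAbs := by
  classical
  unfold icost
  symm
  refine Finset.sum_bij (fun i _ => s(0, i.succ)) ?_ ?_ ?_ ?_
  · intro i _
    rw [SimpleGraph.mem_edgeFinset, SimpleGraph.mem_edgeSet, starTree, SimpleGraph.fromRel_adj]
    exact ⟨(Fin.succ_ne_zero i).symm, Or.inl rfl⟩
  · intro i _ j _ h
    simpa using h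
  · intro e
    induction e using Sym2.ind with
    | _ u v =>
      intro h
      rw [SimpleGraph.mem_edgeFinset, SimpleGraph.mem_edgeSet, starTree,
        SimpleGraph.fromRel_adj] at h
      obtain ⟨hne, rfl | rfl⟩ := h
      · obtain ⟨i, rfl⟩ := Fin.exists_succ_eq.2 (Ne.symm hne)
        exact ⟨i, Finset.mem_univ _, rfl⟩
      · obtain ⟨i, rfl⟩ := Fin.exists_succ_eq.2 hne
        exact ⟨i, Finset.mem_univ _, Sym2.eq_swap⟩
  · intro i _
    rfl

lemma sum_range_le_sum_finset (n : ℕ) :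
    ∀ s : Finset ℕ, s.card = n → ∑ i ∈ Finset.range n, i ≤ ∑ i ∈ s, i := by
  induction n with
  | zero => intro s _; simp
  | succ n ih =>
    intro s hs
    obtain ⟨x, hx, hxn⟩ : ∃ x ∈ s, n ≤ x := by
      by_contra! hc
      have h1 : s ⊆ Finset.range n := fun x hx => Finset.mem_range.2 (hc x hx)
      have h2 := Finset.card_le_card h1
      simp at h2
      omega
    have h3 := ih (s.erase x) (by rw [Finset.card_erase_of_mem hx]; omega)
    rw [Finset.sum_range_succ, ← Finset.sum_erase_add _ _ hx]
    omega

lemma star_total (m z : ℕ) (hz : m + 1 ≤ z) :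
    m * (2 * z - m - 1) / 2 + ∑ i ∈ Finset.range m, i = m * (z - 1) := by
  have h := Finset.sum_range_id_mul_two m
  obtain ⟨c, rfl⟩ := Nat.exists_eq_add_of_le hz
  have e1 : 2 * (m + 1 + c) - m - 1 = m + 1 + 2 * c := by omega
  have e2 : m + 1 + c - 1 = m + c := by omega
  rw [e1, e2]
  have h2 : m * (m + 1 + 2 * c) + (∑ i ∈ Finset.range m, i) * 2 = 2 * (m * (m + c)) := by
    rw [h]
    cases m with
    | zero => simp
    | succ k => simp only [Nat.add_sub_cancel]; ring
  omega

lemma star_upper {m z : ℕ} (hz : m + 1 ≤ z) (π : Fin (m + 1) ↪ Fin z) :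
    icost (starTree (m + 1) 0) π ≤ m * (2 * z - m - 1) / 2 := by
  rw [star_cost]
  have ht := star_total m z hz
  -- an injective upper bound for the distances
  let f : Fin m → ℕ := fun i =>
    if (π 0 : ℕ) < π i.succ then (π i.succ : ℕ) else (π 0 : ℕ) - π i.succ
  have hne : ∀ i : Fin m, (π i.succ : ℕ) ≠ π 0 := by
    intro i h
    exact Fin.succ_ne_zero i (π.injective (Fin.ext h))
  have hf : ∀ i, f i ≤ z - 1 := by
    intro i
    have := (π i.succ).isLt
    have := (π 0).isLt
    simp only [f]; split_ifs <;> omega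
  have hinj : Function.Injective (fun i => z - 1 - f i) := by
    intro i j h
    have h1 := hf i
    have h2 := hf j
    have h3 : f i = f j := by
      dsimp only at h; omega
    have a1 := hne i
    have a2 := hne j
    have : (π i.succ : ℕ) = π j.succ := by
      simp only [f] at h3
      split_ifs at h3 <;> omega
    exact Fin.succ_injective _ (π.injective (Fin.ext this))
  have hs := sum_range_le_sum_finset m (Finset.univ.image (fun i => z - 1 - f i))
    (by rw [Finset.card_image_of_injective _ hinj]; simp)
  rw [Finset.sum_image (fun i _ j _ h => hinj h)] at hs
  have hsum : (∑ i : Fin m, (((π 0 : ℕ) : ℤ) - ((π i.succ : ℕ) : ℤ)).natAbs)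
      + ∑ i : Fin m, (z - 1 - f i) ≤ m * (z - 1) := by
    rw [← Finset.sum_add_distrib]
    calc _ ≤ ∑ _i : Fin m, (z - 1) := by
          refine Finset.sum_le_sum fun i _ => ?_
          have h1 := hf i
          have h2 : (((π 0 : ℕ) : ℤ) - ((π i.succ : ℕ) : ℤ)).natAbs ≤ f i := by
            simp only [f]; split_ifs <;> omega
          omega
      _ = m * (z - 1) := by simp
  omega

lemma star_attained (m z : ℕ) (hz : m + 1 ≤ z) :
    ∃ π : Fin (m + 1) ↪ Fin z, (π 0 : ℕ) = 0 ∧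
      (∀ v : Fin (m + 1), v ≠ 0 → z - m ≤ (π v : ℕ)) ∧
      icost (starTree (m + 1) 0) π = m * (2 * z - m - 1) / 2 := by
  let π : Fin (m + 1) ↪ Fin z :=
    ⟨fun v => ⟨if (v : ℕ) = 0 then 0 else z - v, by split_ifs <;> omega⟩, by
      intro u v h
      have h' := congrArg Fin.val h
      apply Fin.ext
      have := u.isLt
      have := v.isLt
      dsimp only at h'
      split_ifs at h' <;> omega⟩
  have h0 : (π 0 : ℕ) = 0 := by simp [π]
  have h1 : ∀ i : Fin m, (π i.succ : ℕ) = z - 1 - i := by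
    intro i
    change (if (i.succ : ℕ) = 0 then 0 else z - (i.succ : ℕ)) = _
    rw [Fin.val_succ, if_neg (Nat.succ_ne_zero _)]
    have hi := i.isLt
    rw [Nat.sub_sub, Nat.add_comm]
  refine ⟨π, h0, ?_, ?_⟩
  · intro v hv
    obtain ⟨i, rfl⟩ := Fin.exists_succ_eq.2 hv
    rw [h1]
    have := i.isLt
    omega
  · rw [star_cost]
    have ht := star_total m z hz
    have hs : (∑ i : Fin m, (((π 0 : ℕ) : ℤ) - ((π i.succ : ℕ) : ℤ)).natAbs)
        + ∑ i ∈ Finset.range m, i = m * (z - 1) := by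
      rw [← Fin.sum_univ_eq_sum_range (fun i => i), ← Finset.sum_add_distrib]
      calc _ = ∑ _i : Fin m, (z - 1) := by
            refine Finset.sum_congr rfl fun i _ => ?_
            rw [h0, h1]
            have := i.isLt
            omega
        _ = m * (z - 1) := by simp
    omega

theorem max_icost_star (m z : ℕ) (hz : m + 1 ≤ z) :
    Finset.univ.sup (fun π : Fin (m + 1) ↪ Fin z => icost (starTree (m + 1) 0) π)
        = m * (2 * z - m - 1) / 2 ∧
    ∃ π : Fin (m + 1) ↪ Fin z, (π 0 : ℕ) = 0 ∧
      (∀ v : Fin (m + 1), v ≠ 0 → z - m ≤ (π v : ℕ)) ∧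
      icost (starTree (m + 1) 0) π = m * (2 * z - m - 1) / 2 := by
  refine ⟨le_antisymm (Finset.sup_le fun π _ => star_upper hz π) ?_, star_attained m z hz⟩
  obtain ⟨π, -, -, h⟩ := star_attained m z hz
  rw [← h]
  exact Finset.le_sup (f := fun π : Fin (m + 1) ↪ Fin z => icost (starTree (m + 1) 0) π)
    (Finset.mem_univ π)
end

section
/- For all integers k, l ≥ 0 with n = 2k + l + 1, the k-quasistar tree on n vertices has maximum cost D_max equal to (1/2)(n − 1 − k)(3k + n); that is, the maximum over all bijections π : Fin n → Fin n of the sum over its edges {u,v} of |π(u) − π(v)| equals (1/2)(n − 1 − k)(3k + n). -/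
open Finset

/-- The `k`-quasistar tree on `n = 2k + l + 1` vertices: vertex `0` is the hub,
adjacent to the vertices `1, ..., k + l`; among these, each arm vertex `i` with
`1 ≤ i ≤ k` carries one extra leaf, namely the vertex `i + k + l`; the remaining
neighbours `k + 1, ..., k + l` of the hub are leaves. -/
def quasistar (k l : ℕ) : SimpleGraph (Fin (2 * k + l + 1)) :=
  SimpleGraph.fromRel (fun u v =>
    ((u : ℕ) = 0 ∧ 1 ≤ (v : ℕ) ∧ (v : ℕ) ≤ k + l) ∨
    (1 ≤ (u : ℕ) ∧ (u : ℕ) ≤ k ∧ (v : ℕ) = (u : ℕ) + k + l))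

/-- Distinct positive integers: lower bound for the sum. -/
lemma qs_sum_lower (S : Finset ℤ) : (∀ y ∈ S, 1 ≤ y) →
    (S.card : ℤ) * (S.card + 1) ≤ 2 * ∑ y ∈ S, y := by
  induction S using Finset.induction_on_max with
  | empty => simp
  | insert a s hs ih =>
    intro h
    have hna : a ∉ s := fun h' => lt_irrefl _ (hs a h')
    have ih' := ih (fun y hy => h y (Finset.mem_insert_of_mem hy))
    have ha := h a (Finset.mem_insert_self _ _)
    have hc : s.card ≤ (Finset.Icc 1 (a - 1)).card := by
      apply Finset.card_le_card
      intro y hy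
      have := hs y hy
      have := h y (Finset.mem_insert_of_mem hy)
      simp only [Finset.mem_Icc]; omega
    rw [Int.card_Icc] at hc
    have hc' : (s.card : ℤ) ≤ a - 1 := by omega
    rw [Finset.sum_insert hna, Finset.card_insert_of_notMem hna]
    push_cast
    nlinarith

/-- Distinct integers bounded above by `M`: upper bound for the sum. -/
lemma qs_sum_upper (S : Finset ℤ) (M : ℤ) (h : ∀ y ∈ S, y ≤ M) :
    2 * ∑ y ∈ S, y ≤ (S.card : ℤ) * (2 * M - S.card + 1) := by
  have hinj : Set.InjOn (fun y : ℤ => M + 1 - y) S := by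
    intro a _ b _ hab
    simp only at hab; omega
  have := qs_sum_lower (S.image (fun y => M + 1 - y)) (by
    intro y hy
    obtain ⟨z, hz, rfl⟩ := Finset.mem_image.1 hy
    have := h z hz
    omega)
  rw [Finset.card_image_of_injOn hinj, Finset.sum_image hinj, Finset.sum_sub_distrib] at this
  simp only [Finset.sum_const, nsmul_eq_mul] at this
  nlinarith

lemma qs_sum_abs (h : ℕ) : 2 * ∑ y ∈ Finset.Icc (1 : ℤ) h, y = h * (h + 1) := by
  induction h with
  | zero => simp
  | succ n ih =>
    have : Finset.Icc (1 : ℤ) ((n + 1 : ℕ) : ℤ) = insert ((n : ℤ) + 1) (Finset.Icc (1 : ℤ) n) := by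
      ext y; simp only [Finset.mem_Icc, Finset.mem_insert]; push_cast; omega
    rw [this, Finset.sum_insert (by simp), mul_add, ih]
    push_cast; ring

/-- Sum of the absolute values of the relative positions. -/
lemma qs_sum_all (h h' : ℕ) :
    2 * ∑ y ∈ Finset.Icc (-(h : ℤ)) h', |y| = h * (h + 1) + h' * (h' + 1) := by
  have e : Finset.Icc (-(h : ℤ)) h' =
      ((Finset.Icc (1 : ℤ) h).image (fun y => -y)) ∪ ({0} ∪ Finset.Icc (1 : ℤ) h') := by
    ext y
    simp only [Finset.mem_Icc, Finset.mem_union, Finset.mem_image, Finset.mem_singleton]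
    constructor
    · intro hy
      by_cases h1 : y < 0
      · left; exact ⟨-y, by omega, by omega⟩
      · right; omega
    · rintro (⟨z, hz, rfl⟩ | hy | hy) <;> omega
  rw [e, Finset.sum_union, Finset.sum_union, Finset.sum_image, ← qs_sum_abs h, ← qs_sum_abs h']
  · have h1 : ∑ y ∈ Finset.Icc (1 : ℤ) h, |(-y)| = ∑ y ∈ Finset.Icc (1 : ℤ) h, y := by
      apply Finset.sum_congr rfl
      intro y hy
      rw [Finset.mem_Icc] at hy
      rw [abs_neg, abs_of_nonneg (by omega)]
    have h2 : ∑ y ∈ Finset.Icc (1 : ℤ) h', |y| = ∑ y ∈ Finset.Icc (1 : ℤ) h', y := by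
      apply Finset.sum_congr rfl
      intro y hy
      rw [Finset.mem_Icc] at hy
      rw [abs_of_nonneg (by omega)]
    rw [h1, h2]; simp; ring
  · intro a _ b _ hab
    simpa using hab
  · rw [Finset.disjoint_left]; intro y hy; simp at hy ⊢; omega
  · rw [Finset.disjoint_left]; intro y hy
    simp only [Finset.mem_Icc, Finset.mem_union, Finset.mem_image, Finset.mem_singleton] at hy ⊢
    obtain ⟨z, hz, rfl⟩ := hy
    omega

/-- The main upper bound, in terms of positions relative to the hub, the hub being in the
left half. -/
lemma qs_main (k l h h' : ℕ) (x : ℕ → ℤ) (hN : h + h' = 2 * k + l) (hh : h ≤ h')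
    (hinj : ∀ i ≤ 2 * k + l, ∀ j ≤ 2 * k + l, x i = x j → i = j)
    (hx0 : x 0 = 0) (hlo : ∀ i ≤ 2 * k + l, -(h : ℤ) ≤ x i)
    (hhi : ∀ i ≤ 2 * k + l, x i ≤ h') :
    2 * (∑ i ∈ range (k + l), |x (i + 1)| +
      ∑ i ∈ range k, |x (i + 1) - x (i + 1 + (k + l))|) ≤
      ((k : ℤ) + l) * (k + l + 1 + 4 * k) := by
  have hne : ∀ i, 1 ≤ i → i ≤ 2 * k + l → x i ≠ 0 := by
    intro i h1 h2 h0
    have := hinj i h2 0 (by omega) (by rw [h0, hx0])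
    omega
  -- total sum
  have himg : (range (2 * k + l + 1)).image x = Finset.Icc (-(h : ℤ)) h' := by
    apply Finset.eq_of_subset_of_card_le
    · intro y hy
      obtain ⟨i, hi, rfl⟩ := Finset.mem_image.1 hy
      rw [Finset.mem_range] at hi
      exact Finset.mem_Icc.2 ⟨hlo i (by omega), hhi i (by omega)⟩
    · rw [Finset.card_image_of_injOn, Int.card_Icc, Finset.card_range]
      · omega
      · intro i hi j hj
        simp only [Finset.coe_range, Set.mem_Iio] at hi hj
        exact hinj i (by omega) j (by omega)
  have htot : 2 * (∑ i ∈ range (k + l), |x (i + 1)| + ∑ i ∈ range k, |x (i + 1 + (k + l))|)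
      = (h : ℤ) * (h + 1) + h' * (h' + 1) := by
    rw [← qs_sum_all h h', ← himg, Finset.sum_image, Finset.sum_range_succ', hx0,
      show 2 * k + l = (k + l) + k by ring, Finset.sum_range_add _ (k + l) k]
    · simp only [abs_zero, add_zero]
      congr 2
      apply Finset.sum_congr rfl
      intro i _
      congr 2; ring
    · intro i hi j hj
      simp only [Finset.coe_range, Set.mem_Iio] at hi hj
      exact hinj i (by omega) j (by omega)
  set mn : ℕ → ℤ := fun i => min (x (i + 1)) (x (i + 1 + (k + l))) with hmn
  have hmninj : ∀ i < k, ∀ j < k, mn i = mn j → i = j := by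
    intro i hi j hj hij
    simp only [hmn] at hij
    have a1 := hinj (i + 1) (by omega) (j + 1) (by omega)
    have a2 := hinj (i + 1) (by omega) (j + 1 + (k + l)) (by omega)
    have a3 := hinj (i + 1 + (k + l)) (by omega) (j + 1) (by omega)
    have a4 := hinj (i + 1 + (k + l)) (by omega) (j + 1 + (k + l)) (by omega)
    rcases min_choice (x (i + 1)) (x (i + 1 + (k + l))) with e | e <;>
    rcases min_choice (x (j + 1)) (x (j + 1 + (k + l))) with e' | e' <;>
    rw [e, e'] at hij
    · have := a1 hij; omega
    · have := a2 hij; omega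
    · have := a3 hij; omega
    · have := a4 hij; omega
  have hmn0 : ∀ i < k, mn i ≠ 0 := by
    intro i hi
    have := hne (i + 1) (by omega) (by omega)
    have := hne (i + 1 + (k + l)) (by omega) (by omega)
    simp only [hmn]; omega
  set Q := (range k).filter (fun i => 0 < mn i) with hQ
  set R := (range k).filter (fun i => ¬ 0 < mn i) with hR
  have hQR : Q.card + R.card = k := by
    rw [hQ, hR, Finset.card_filter_add_card_filter_not, Finset.card_range]
  have hRh : R.card ≤ h := by
    have : R.card ≤ (Finset.Icc (-(h : ℤ)) (-1)).card := by
      apply Finset.card_le_card_of_injOn mn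
      · intro i hi
        simp only [hR, Finset.coe_filter, Set.mem_ofPred_eq, Finset.mem_range] at hi
        have b0 := hmn0 i hi.1
        have b1 := hlo (i + 1) (by omega)
        have b2 := hlo (i + 1 + (k + l)) (by omega)
        have b3 : -(h : ℤ) ≤ mn i := le_min b1 b2
        simp only [Finset.coe_Icc, Set.mem_Icc]
        omega
      · intro i hi j hj
        simp only [hR, Finset.coe_filter, Set.mem_ofPred_eq, Finset.mem_range] at hi hj
        exact hmninj i hi.1 j hj.1
    rw [Int.card_Icc] at this
    omega
  have hQsum : (Q.card : ℤ) * (Q.card + 1) ≤ 2 * ∑ i ∈ Q, mn i := by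
    have hi : Set.InjOn mn Q := by
      intro i hi j hj
      simp only [hQ, Finset.coe_filter, Set.mem_ofPred_eq, Finset.mem_range] at hi hj
      exact hmninj i hi.1 j hj.1
    have := qs_sum_lower (Q.image mn) (by
      intro y hy
      obtain ⟨i, hi, rfl⟩ := Finset.mem_image.1 hy
      simp only [hQ, Finset.mem_filter] at hi
      omega)
    rwa [Finset.card_image_of_injOn hi, Finset.sum_image hi] at this
  -- extra contribution
  have hextra : ∑ i ∈ range k, |x (i + 1) - x (i + 1 + (k + l))| ≤
      ∑ i ∈ range k, |x (i + 1 + (k + l))| + ∑ i ∈ range k, |x (i + 1)| - 2 * ∑ i ∈ Q, mn i := by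
    rw [hQ, Finset.sum_filter, Finset.mul_sum, ← Finset.sum_add_distrib, ← Finset.sum_sub_distrib]
    apply Finset.sum_le_sum
    intro i _
    simp only [hmn]
    split_ifs with hc
    · have c1 := (lt_min_iff.1 hc).1
      have c2 := (lt_min_iff.1 hc).2
      rw [abs_of_pos c1, abs_of_pos c2]
      rcases le_total (x (i + 1)) (x (i + 1 + (k + l))) with c | c
      · rw [min_eq_left c, abs_of_nonpos (by omega)]; omega
      · rw [min_eq_right c, abs_of_nonneg (by omega)]; omega
    · have := abs_sub (x (i + 1)) (x (i + 1 + (k + l)))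
      omega
  have hQnn : 0 ≤ ∑ i ∈ Q, mn i := by nlinarith
  rcases le_or_gt k h with hkh | hkh
  · have harms : ∑ i ∈ range k, |x (i + 1)| ≤ (k : ℤ) * h' := by
      have := Finset.sum_le_card_nsmul (range k) (fun i => |x (i + 1)|) (h' : ℤ) (by
        intro i hi
        rw [Finset.mem_range] at hi
        have b1 := hlo (i + 1) (by omega)
        have b2 := hhi (i + 1) (by omega)
        rw [abs_le]; omega)
      simpa using this
    have hl : (l : ℤ) = h + h' - 2 * k := by omega
    have h1 : 2 * (k : ℤ) ≤ h + h' := by omega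
    zify at hkh hh
    have h2 : 0 ≤ ((h : ℤ) - k) * h' := mul_nonneg (by omega) (by omega)
    have h3 : 0 ≤ (k : ℤ) * (2 * ((h : ℤ) + h' - k) - (k + 1)) := by
      rcases Nat.eq_zero_or_pos k with h0 | h0
      · simp [h0]
      · apply mul_nonneg <;> omega
    have h4 : 0 ≤ (h : ℤ) * h' := by positivity
    rw [hl]
    nlinarith
  · -- left and right arms
    set A := (range k).filter (fun i => x (i + 1) < 0) with hA
    set B := (range k).filter (fun i => ¬ x (i + 1) < 0) with hB
    have hAB : A.card + B.card = k := by
      rw [hA, hB, Finset.card_filter_add_card_filter_not, Finset.card_range]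
    have hsplit : ∑ i ∈ range k, |x (i + 1)| = ∑ i ∈ A, (- x (i + 1)) + ∑ i ∈ B, x (i + 1) := by
      rw [← Finset.sum_filter_add_sum_filter_not (range k) (fun i => x (i + 1) < 0)]
      congr 1
      · apply Finset.sum_congr rfl
        intro i hi
        rw [Finset.mem_filter] at hi
        exact abs_of_neg hi.2
      · apply Finset.sum_congr rfl
        intro i hi
        rw [Finset.mem_filter] at hi
        exact abs_of_nonneg (by omega)
    have hAs : 2 * ∑ i ∈ A, (- x (i + 1)) ≤ (h : ℤ) * (h + 1) := by
      rw [← qs_sum_abs h]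
      have hi : Set.InjOn (fun i => - x (i + 1)) A := by
        intro i hi j hj hij
        simp only [hA, Finset.coe_filter, Set.mem_ofPred_eq, Finset.mem_range] at hi hj
        have := hinj (i + 1) (by omega) (j + 1) (by omega) (by simpa using hij)
        omega
      rw [← Finset.sum_image (f := fun y => y) hi]
      apply mul_le_mul_of_nonneg_left _ (by norm_num)
      apply Finset.sum_le_sum_of_subset_of_nonneg
      · intro y hy
        obtain ⟨i, hi, rfl⟩ := Finset.mem_image.1 hy
        simp only [hA, Finset.mem_filter, Finset.mem_range] at hi
        have b1 := hlo (i + 1) (by omega)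
        rw [Finset.mem_Icc]; omega
      · intro y hy _
        rw [Finset.mem_Icc] at hy; omega
    have hBs : 2 * ∑ i ∈ B, x (i + 1) ≤ (B.card : ℤ) * (2 * h' - B.card + 1) := by
      have hi : Set.InjOn (fun i => x (i + 1)) B := by
        intro i hi j hj hij
        simp only [hB, Finset.coe_filter, Set.mem_ofPred_eq, Finset.mem_range] at hi hj
        have := hinj (i + 1) (by omega) (j + 1) (by omega) hij
        omega
      have := qs_sum_upper (B.image (fun i => x (i + 1))) h' (by
        intro y hy
        obtain ⟨i, hi, rfl⟩ := Finset.mem_image.1 hy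
        simp only [hB, Finset.mem_filter, Finset.mem_range] at hi
        exact hhi (i + 1) (by omega))
      rwa [Finset.card_image_of_injOn hi, Finset.sum_image hi] at this
    have hBk : (B.card : ℤ) * (2 * h' - B.card + 1) ≤ (k : ℤ) * (2 * h' - k + 1) := by
      have : (0 : ℤ) ≤ ((k : ℤ) - B.card) * (2 * h' + 1 - k - B.card) :=
        mul_nonneg (by omega) (by omega)
      nlinarith
    have hQk : ((k : ℤ) - h) * (k - h + 1) ≤ (Q.card : ℤ) * (Q.card + 1) := by
      have h5 : (k : ℤ) - h ≤ Q.card := by omega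
      apply mul_le_mul h5 (by omega) (by omega) (by omega)
    have hE : 2 * (∑ i ∈ range (k + l), |x (i + 1)| +
      ∑ i ∈ range k, |x (i + 1) - x (i + 1 + (k + l))|) ≤ (h : ℤ) * (h + 1) + h' * (h' + 1)
        + h * (h + 1) + k * (2 * h' - k + 1) - 2 * (((k : ℤ) - h) * (k - h + 1)) := by
      linarith
    refine hE.trans ?_
    have hh2 : (h' : ℤ) = 2 * k + l - h := by omega
    rw [hh2]
    have h6 : 0 ≤ (h : ℤ) * (2 * (k + l) - 2 - (h + 1)) := by
      rcases Nat.eq_zero_or_pos h with h0 | h0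
      · simp [h0]
      · apply mul_nonneg <;> omega
    have h7 : 0 ≤ (h : ℤ) * (k - h) := by apply mul_nonneg <;> omega
    have h8 : 0 ≤ (h : ℤ) * l := by positivity
    nlinarith

/-- Position of the vertex with index `j`. -/
def qsPos (k l : ℕ) (π : Equiv.Perm (Fin (2 * k + l + 1))) (j : ℕ) : ℤ :=
  ((π (Fin.ofNat (2 * k + l + 1) j) : ℕ) : ℤ)

/-- Parent of the vertex `j + 1`. -/
def qsPar (k l j : ℕ) : ℕ := if j < k + l then 0 else j + 1 - (k + l)

lemma qsPar_spec (k l j : ℕ) : (j < k + l ∧ qsPar k l j = 0) ∨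
    (k + l ≤ j ∧ qsPar k l j + (k + l) = j + 1) := by
  unfold qsPar; split_ifs <;> omega

lemma qs_ofNat_val (N j : ℕ) (h : j ≤ N) : ((Fin.ofNat (N + 1) j : Fin (N + 1)) : ℕ) = j := by
  simp [Fin.ofNat, Nat.mod_eq_of_lt (Nat.lt_succ_of_le h)]

lemma qs_cost_eq (k l : ℕ) (π : Equiv.Perm (Fin (2 * k + l + 1))) :
    ((cost (quasistar k l) π : ℕ) : ℤ) =
      ∑ i ∈ range (k + l), |qsPos k l π (i + 1) - qsPos k l π 0| +
      ∑ i ∈ range k, |qsPos k l π (i + 1) - qsPos k l π (i + 1 + (k + l))| := by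
  classical
  have key : ((cost (quasistar k l) π : ℕ) : ℤ) =
      ∑ j ∈ range (2 * k + l), |qsPos k l π (qsPar k l j) - qsPos k l π (j + 1)| := by
    unfold cost
    push_cast
    symm
    refine Finset.sum_bij (fun j _ => s(Fin.ofNat (2 * k + l + 1) (qsPar k l j),
      Fin.ofNat (2 * k + l + 1) (j + 1))) ?_ ?_ ?_ ?_
    · intro j hj
      rw [Finset.mem_range] at hj
      have hp : qsPar k l j ≤ 2 * k + l := by unfold qsPar; split_ifs <;> omega
      rw [SimpleGraph.mem_edgeFinset, SimpleGraph.mem_edgeSet, quasistar,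
        SimpleGraph.fromRel_adj, Ne, Fin.ext_iff, qs_ofNat_val _ _ hp,
        qs_ofNat_val _ (j + 1) (by omega)]
      have := qsPar_spec k l j
      omega
    · intro i hi j hj hij
      rw [Finset.mem_range] at hi hj
      have hp : qsPar k l i ≤ 2 * k + l := by unfold qsPar; split_ifs <;> omega
      have hp' : qsPar k l j ≤ 2 * k + l := by unfold qsPar; split_ifs <;> omega
      rw [Sym2.eq_iff] at hij
      simp only [Fin.ext_iff] at hij
      rw [qs_ofNat_val _ _ hp, qs_ofNat_val _ _ hp', qs_ofNat_val _ (j + 1) (by omega),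
        qs_ofNat_val _ (i + 1) (by omega)] at hij
      have := qsPar_spec k l j
      have := qsPar_spec k l i
      omega
    · intro e he
      rw [SimpleGraph.mem_edgeFinset] at he
      have main : ∀ u v : Fin (2 * k + l + 1), (((u : ℕ) = 0 ∧ 1 ≤ (v : ℕ) ∧ (v : ℕ) ≤ k + l) ∨
          (1 ≤ (u : ℕ) ∧ (u : ℕ) ≤ k ∧ (v : ℕ) = (u : ℕ) + k + l)) →
          ∃ j, ∃ _ : j ∈ range (2 * k + l), s(Fin.ofNat (2 * k + l + 1) (qsPar k l j),
            Fin.ofNat (2 * k + l + 1) (j + 1)) = s(u, v) := by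
        intro u v huv
        have hv := v.2
        refine ⟨(v : ℕ) - 1, by rw [Finset.mem_range]; omega, ?_⟩
        have hp : qsPar k l ((v : ℕ) - 1) = u := by unfold qsPar; split_ifs <;> omega
        rw [Sym2.eq_iff]
        left
        rw [hp, Fin.ext_iff, Fin.ext_iff, qs_ofNat_val _ _ (by omega), qs_ofNat_val _ _ (by omega)]
        omega
      induction e using Sym2.ind with
      | _ u v =>
        rw [SimpleGraph.mem_edgeSet, quasistar, SimpleGraph.fromRel_adj] at he
        rcases he.2 with h1 | h1
        · exact main u v h1
        · rw [Sym2.eq_swap]; exact main v u h1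
    · intro j hj
      simp [qsPos]
  rw [key, show 2 * k + l = (k + l) + k by ring, Finset.sum_range_add]
  congr 1
  · apply Finset.sum_congr rfl
    intro i hi
    rw [Finset.mem_range] at hi
    rw [qsPar, if_pos hi, abs_sub_comm]
  · apply Finset.sum_congr rfl
    intro i hi
    rw [qsPar, if_neg (by omega)]
    congr 3 <;> omega

lemma qs_upper (k l : ℕ) (π : Equiv.Perm (Fin (2 * k + l + 1))) :
    2 * ((cost (quasistar k l) π : ℕ) : ℤ) ≤ ((k : ℤ) + l) * (k + l + 1 + 4 * k) := by
  rw [qs_cost_eq]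
  obtain ⟨h, hh⟩ : ∃ h : ℕ, qsPos k l π 0 = h := ⟨_, rfl⟩
  have hinj : ∀ i ≤ 2 * k + l, ∀ j ≤ 2 * k + l, qsPos k l π i = qsPos k l π j → i = j := by
    intro i hi j hj hij
    unfold qsPos at hij
    have := π.injective (Fin.ext (by exact_mod_cast hij))
    rw [Fin.ext_iff, qs_ofNat_val _ _ hi, qs_ofNat_val _ _ hj] at this
    exact this
  have hlo : ∀ i, 0 ≤ qsPos k l π i := fun i => by unfold qsPos; omega
  have hhi : ∀ i, qsPos k l π i ≤ 2 * k + l := fun i => by unfold qsPos; omega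
  have hN := hhi 0
  rcases le_total h (2 * k + l - h) with hc | hc
  · have := qs_main k l h (2 * k + l - h) (fun i => qsPos k l π i - qsPos k l π 0)
      (by omega) hc (fun i hi j hj hij => hinj i hi j hj (by simpa using hij)) (by simp)
      (fun i _ => by have := hlo i; omega)
      (fun i _ => by have := hhi i; omega)
    simpa using this
  · have := qs_main k l (2 * k + l - h) h (fun i => qsPos k l π 0 - qsPos k l π i)
      (by omega) hc (fun i hi j hj hij => hinj i hi j hj (by simpa using hij)) (by simp)
      (fun i _ => by have := hhi i; omega)
      (fun i _ => by have := hlo i; omega)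
    refine le_trans (le_of_eq ?_) this
    congr 2
    · apply Finset.sum_congr rfl
      intro i _
      rw [abs_sub_comm]
    · apply Finset.sum_congr rfl
      intro i _
      rw [abs_sub_comm]
      congr 1; ring

lemma qs_attained (k l : ℕ) :
    2 * ((cost (quasistar k l) (Equiv.neg (Fin (2 * k + l + 1))) : ℕ) : ℤ) =
      ((k : ℤ) + l) * (k + l + 1 + 4 * k) := by
  have h0 : qsPos k l (Equiv.neg (Fin (2 * k + l + 1))) 0 = 0 := by
    simp [qsPos]
  have hj : ∀ j, 1 ≤ j → j ≤ 2 * k + l →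
      qsPos k l (Equiv.neg (Fin (2 * k + l + 1))) j = 2 * k + l + 1 - j := by
    intro j h1 h2
    unfold qsPos
    rw [Equiv.neg_apply, Fin.val_neg', qs_ofNat_val _ _ h2, Nat.mod_eq_of_lt (by omega)]
    omega
  rw [qs_cost_eq, h0]
  have e1 : ∀ m : ℕ, m ≤ 2 * k + l → 2 * ∑ i ∈ range m,
      |qsPos k l (Equiv.neg (Fin (2 * k + l + 1))) (i + 1) - 0| =
      (m : ℤ) * (2 * (2 * k + l) + 1 - m) := by
    intro m
    induction m with
    | zero => simp
    | succ m ih =>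
      intro hm
      rw [Finset.sum_range_succ, mul_add, ih (by omega), hj _ (by omega) hm, sub_zero,
        abs_of_nonneg (by push_cast; omega)]
      push_cast; ring
  have e2 : ∑ i ∈ range k, |qsPos k l (Equiv.neg (Fin (2 * k + l + 1))) (i + 1) -
      qsPos k l (Equiv.neg (Fin (2 * k + l + 1))) (i + 1 + (k + l))| = (k : ℤ) * (k + l) := by
    rw [Finset.sum_congr rfl (g := fun _ => (k : ℤ) + l)]
    · simp
    · intro i hi
      rw [Finset.mem_range] at hi
      rw [hj _ (by omega) (by omega), hj _ (by omega) (by omega), abs_of_nonneg] <;>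
        push_cast <;> omega
  rw [mul_add, e1 _ (by omega), e2]
  push_cast; ring

theorem Dmax_quasistar (k l : ℕ) :
    Finset.univ.sup (fun π : Equiv.Perm (Fin (2 * k + l + 1)) => cost (quasistar k l) π)
      = (2 * k + l + 1 - 1 - k) * (3 * k + (2 * k + l + 1)) / 2 := by
  have e : (2 * k + l + 1 - 1 - k) * (3 * k + (2 * k + l + 1)) =
      (k + l) * (k + l + 1 + 4 * k) := by
    rw [show 2 * k + l + 1 - 1 - k = k + l by omega]; ring
  rw [e]
  apply le_antisymm
  · apply Finset.sup_le
    intro π _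
    have := qs_upper k l π
    rw [Nat.le_div_iff_mul_le (by norm_num), mul_comm]
    exact_mod_cast this
  · refine le_trans (le_of_eq ?_) (Finset.le_sup (Finset.mem_univ (Equiv.neg _)))
    have h : 2 * cost (quasistar k l) (Equiv.neg (Fin (2 * k + l + 1))) =
      (k + l) * (k + l + 1 + 4 * k) := by exact_mod_cast qs_attained k l
    omega
end
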